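/- arXiv:math/0403277 — 2 statements merged into one kernel-verified Lean document; each statement's English description precedes it below -/
import Mathlib

section
/- Let μ, l ≥ 1, s ≥ 0, 1 ≤ ρ ≤ μ, m ≥ 1 with gcd(m, μ+1) = 1, and set N = (s+l+1)μ + s + ρ and κ₀ = −m/(μ+1). Then there exists a nonzero polynomial f ∈ ℚ[x_1,…,x_N], homogeneous of degree |Λ(μ,s,l,ρ,m)| = m(ρ(s+l+1) + μ Σ_{i=1}^{l} (s+i)), such that D_i f = 0 for every 1 ≤ i ≤ N, where D_i is the Dunkl operator with parameter κ₀. In particular κ₀ = −m/(μ+1) is a singular value for the symmetric group S_N. -/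
open Finset MvPolynomial

/-- The row of the `j`-th cell, in reading order, of the Young diagram whose first row has length
`s * μ + s + μ` and whose further rows have length `μ`. -/
def cellRow (μ s j : ℕ) : ℕ :=
  if j < s * μ + s + μ then 0 else (j - (s * μ + s + μ)) / μ + 1

/-- The content (column minus row) of the `j`-th cell. -/
def cellContent (μ s j : ℕ) : ℤ :=
  if cellRow μ s j = 0 then j else j - (μ + 1) * (s + cellRow μ s j)

/-- The index of the first cell of row `r`. -/
def rowStart (μ s r : ℕ) : ℕ := if r = 0 then 0 else s * μ + s + r * μ

section Cells

variable {μ s : ℕ}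

lemma cellRow_eq_zero_iff {j : ℕ} : cellRow μ s j = 0 ↔ j < s * μ + s + μ := by
  unfold cellRow; split_ifs <;> simp_all

lemma cellContent_of_row_zero {j : ℕ} (h : cellRow μ s j = 0) : cellContent μ s j = j := by
  simp [cellContent, h]

lemma exists_column (hμ : 1 ≤ μ) {j : ℕ} (h : cellRow μ s j ≠ 0) :
    ∃ c < μ, j = s * μ + s + cellRow μ s j * μ + c ∧ cellContent μ s j = c - cellRow μ s j := by
  have hj : ¬ j < s * μ + s + μ := fun h' => h (cellRow_eq_zero_iff.2 h')
  have hr : cellRow μ s j = (j - (s * μ + s + μ)) / μ + 1 := by simp [cellRow, hj]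
  have hd := Nat.div_add_mod (j - (s * μ + s + μ)) μ
  have hj' : j = s * μ + s + cellRow μ s j * μ + (j - (s * μ + s + μ)) % μ := by
    rw [hr]
    generalize (j - (s * μ + s + μ)) / μ = q at *
    generalize (j - (s * μ + s + μ)) % μ = c at *
    have : (q + 1) * μ = μ * q + μ := by ring
    omega
  refine ⟨(j - (s * μ + s + μ)) % μ, Nat.mod_lt _ hμ, hj', ?_⟩
  rw [cellContent, if_neg h]
  have : (j : ℤ) = _ := congrArg Nat.cast hj'
  push_cast at this
  push_cast
  rw [this]
  ring

lemma cellRow_rowStart_add (hμ : 1 ≤ μ) {r c : ℕ} (hr : r ≠ 0) (hc : c < μ) :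
    cellRow μ s (s * μ + s + r * μ + c) = r := by
  obtain ⟨r, rfl⟩ := Nat.exists_eq_succ_of_ne_zero hr
  have h : ¬ s * μ + s + (r + 1) * μ + c < s * μ + s + μ := by
    have : (r + 1) * μ = r * μ + μ := by ring
    omega
  have h2 : s * μ + s + (r + 1) * μ + c - (s * μ + s + μ) = c + μ * r := by
    have : (r + 1) * μ = μ * r + μ := by ring
    omega
  simp only [cellRow, Nat.succ_eq_add_one, h, if_false, h2]
  rw [Nat.add_mul_div_left _ _ hμ, Nat.div_eq_of_lt hc, zero_add]

lemma cellRow_rowStart (hμ : 1 ≤ μ) (r : ℕ) : cellRow μ s (rowStart μ s r) = r := by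
  unfold rowStart
  split_ifs with h
  · subst h; rw [cellRow_eq_zero_iff]; omega
  · simpa using cellRow_rowStart_add (s := s) (c := 0) hμ h hμ

lemma cellContent_rowStart (hμ : 1 ≤ μ) (r : ℕ) :
    cellContent μ s (rowStart μ s r) = -(r : ℤ) := by
  have h := cellRow_rowStart (s := s) hμ r
  by_cases hr : r = 0
  · subst hr
    rw [cellContent_of_row_zero h]; simp [rowStart]
  · rw [cellContent, h, if_neg hr, rowStart, if_neg hr]; push_cast; ring

lemma cellRow_mono : Monotone (cellRow μ s) := by
  intro i j hij
  unfold cellRow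
  split_ifs with h1 h2
  · exact le_rfl
  · exact Nat.zero_le _
  · omega
  · gcongr

lemma rowStart_le_iff (hμ : 1 ≤ μ) {r j : ℕ} : rowStart μ s r ≤ j ↔ r ≤ cellRow μ s j := by
  constructor
  · intro h
    simpa [cellRow_rowStart hμ] using cellRow_mono (μ := μ) (s := s) h
  · intro h
    unfold rowStart
    split_ifs with hr
    · omega
    · obtain ⟨c, -, hj, -⟩ := exists_column (s := s) (j := j) hμ (by omega)
      have : r * μ ≤ cellRow μ s j * μ := by gcongr
      omega

lemma neg_row_le_cellContent (hμ : 1 ≤ μ) (j : ℕ) :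
    -(cellRow μ s j : ℤ) ≤ cellContent μ s j := by
  by_cases h : cellRow μ s j = 0
  · rw [cellContent_of_row_zero h, h]; simp
  · obtain ⟨c, -, -, hc⟩ := exists_column hμ h
    omega

lemma cellContent_le (hμ : 1 ≤ μ) {j : ℕ} (h : cellRow μ s j ≠ 0) :
    cellContent μ s j ≤ μ - 1 - cellRow μ s j := by
  obtain ⟨c, _, -, hc⟩ := exists_column hμ h
  omega

lemma dvd_cellContent_sub (j : ℕ) : ((μ : ℤ) + 1) ∣ cellContent μ s j - j := by
  unfold cellContent
  split_ifs with h
  · simp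
  · exact ⟨-(s + cellRow μ s j), by ring⟩

/-- Passing from one cell to the next one either stays in the row or starts the next row. -/
lemma cell_succ (hμ : 1 ≤ μ) (j : ℕ) :
    (cellRow μ s (j + 1) = cellRow μ s j ∧ cellContent μ s (j + 1) = cellContent μ s j + 1) ∨
    (cellRow μ s (j + 1) = cellRow μ s j + 1 ∧ j + 1 = rowStart μ s (cellRow μ s j + 1) ∧
      cellContent μ s (j + 1) = -(cellRow μ s j + 1) ∧
      (μ : ℤ) - 1 - cellRow μ s j ≤ cellContent μ s j ∧
      (cellRow μ s j = 0 → cellContent μ s j = s * μ + s + μ - 1)) := by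
  by_cases h : rowStart μ s (cellRow μ s j + 1) ≤ j + 1
  · right
    have h1 : ¬ rowStart μ s (cellRow μ s j + 1) ≤ j := by
      rw [rowStart_le_iff hμ]; omega
    have h2 : j + 1 = rowStart μ s (cellRow μ s j + 1) := by omega
    have h3 : cellRow μ s (j + 1) = cellRow μ s j + 1 := by rw [h2]; exact cellRow_rowStart hμ _
    have h4 := cellContent_rowStart (s := s) hμ (cellRow μ s j + 1)
    rw [← h2] at h4
    have h5 : j + 1 = s * μ + s + (cellRow μ s j + 1) * μ := by
      rw [rowStart, if_neg (by omega)] at h2; exact h2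
    have h0 : cellRow μ s j = 0 → cellContent μ s j = s * μ + s + μ - 1 := by
      intro hz
      rw [cellContent_of_row_zero hz]
      rw [hz] at h5
      zify at h5
      linarith
    refine ⟨h3, h2, by rw [h4]; push_cast; ring, ?_, h0⟩
    by_cases hz : cellRow μ s j = 0
    · rw [h0 hz, hz]
      have : (0 : ℤ) ≤ s * μ := by positivity
      push_cast
      linarith
    · obtain ⟨c, _, hj, hc⟩ := exists_column hμ hz
      have : (cellRow μ s j + 1) * μ = cellRow μ s j * μ + μ := by ring
      omega
  · left
    have h1 : cellRow μ s (j + 1) = cellRow μ s j := by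
      rw [rowStart_le_iff hμ] at h
      have := cellRow_mono (μ := μ) (s := s) (Nat.le_succ j)
      simp only [Nat.succ_eq_add_one] at this
      omega
    refine ⟨h1, ?_⟩
    unfold cellContent
    rw [h1]
    split_ifs <;> push_cast <;> ring

end Cells

section Crossings

/-- The positions at which the sequence `C` of length `N` drops from at least `x - 1` to below `x`,
within the residue class of `x` modulo `n`. -/
def crossings (n N : ℕ) (C : ℕ → ℤ) (x : ℤ) : Finset ℕ :=
  {j ∈ range (N + 1) | (n : ℤ) ∣ j - x ∧ (j = 0 ∨ x ≤ C (j - 1) + 1) ∧ (j < N → C j < x)}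

lemma card_crossings {n N : ℕ} {C : ℕ → ℤ} (x : ℤ) (hC : ∀ j < N, (n : ℤ) ∣ C j - j)
    (hstep : ∀ j, j + 1 < N → C (j + 1) ≤ C j + 1) :
    #(crossings n N C x) + #{j ∈ range N | (n : ℤ) ∣ C j - x ∧ x ≤ C j} =
      #{j ∈ range N | (n : ℤ) ∣ C j - (x - 1) ∧ x - 1 ≤ C j} + if (n : ℤ) ∣ x then 1 else 0 := by
  have h1 : crossings n N C x =
      {j ∈ ({j ∈ range (N + 1) | (n : ℤ) ∣ j - x ∧ (j = 0 ∨ x ≤ C (j - 1) + 1)} : Finset ℕ) |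
        j < N → C j < x} := by
    ext j; simp [crossings, and_assoc]
  have h2 : ({j ∈ range N | (n : ℤ) ∣ C j - x ∧ x ≤ C j} : Finset ℕ) =
      {j ∈ ({j ∈ range (N + 1) | (n : ℤ) ∣ j - x ∧ (j = 0 ∨ x ≤ C (j - 1) + 1)} : Finset ℕ) |
        ¬ (j < N → C j < x)} := by
    ext j
    simp only [mem_filter, mem_range, not_forall, not_lt, exists_prop]
    constructor
    · rintro ⟨hj, hd, hx⟩
      refine ⟨⟨by omega, ?_, ?_⟩, hj, hx⟩
      · have := (hC j hj); have h3 := dvd_sub hd this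
        rwa [show C j - x - (C j - j) = j - x by ring] at h3
      · rcases j with _ | j
        · simp
        · right; have := hstep j hj; simp; omega
    · rintro ⟨⟨-, hd, -⟩, hj, hx⟩
      refine ⟨hj, ?_, hx⟩
      have h3 := dvd_add hd (hC j hj)
      rwa [show j - x + (C j - j) = C j - x by ring] at h3
  rw [h1, h2, card_filter_add_card_filter_not, card_filter, card_filter, sum_range_succ']
  congr 1
  · refine sum_congr rfl fun j hj => ?_
    rw [mem_range] at hj
    have h3 : (n : ℤ) ∣ ((j + 1 : ℕ) : ℤ) - x ↔ (n : ℤ) ∣ C j - (x - 1) := by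
      rw [← dvd_add_left (hC j hj)]
      push_cast
      rw [show (j : ℤ) + 1 - x + (C j - j) = C j - (x - 1) by ring]
    simp only [h3, Nat.add_eq_zero_iff, one_ne_zero, and_false, Nat.add_sub_cancel, false_or,
      sub_le_iff_le_add]
  · simp

/-- The reading-order content sequence has at most one crossing at `μ + 1 - r`. -/
lemma card_crossings_cellContent {μ s l ρ N r : ℕ} (hμ : 1 ≤ μ) (hρ : 1 ≤ ρ) (hρμ : ρ ≤ μ)
    (hN : N = (s + l + 1) * μ + s + ρ) (hr : r ≤ l + 1) :
    #(crossings (μ + 1) N (cellContent μ s) ((μ : ℤ) + 1 - r)) ≤ 1 := by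
  suffices h : ∀ j ∈ crossings (μ + 1) N (cellContent μ s) ((μ : ℤ) + 1 - r),
      j = rowStart μ s r by
    rw [card_le_one]
    intro a ha b hb
    rw [h a ha, h b hb]
  have key : ∀ k : ℕ, ((μ : ℤ) + 1) ∣ (r : ℤ) - k → (k : ℤ) ≤ r → (r : ℤ) < μ + 1 + k →
      k = r := by
    rintro k ⟨d, hd⟩ h1 h2
    have hd0 : d = 0 := by nlinarith
    rw [hd0] at hd; omega
  intro j hj
  simp only [crossings, mem_filter, mem_range] at hj
  obtain ⟨hjN, hd, h0, hlt⟩ := hj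
  push_cast at hd
  have hNst : N = s * μ + s + (l + 1) * μ + ρ := by rw [hN]; ring
  rcases j with _ | j
  · have h1 := hlt (by omega)
    have : cellContent μ s 0 = 0 := by
      simpa [rowStart] using cellContent_rowStart (s := s) hμ 0
    have hr0 := key 0 (by
      have := dvd_sub hd (dvd_refl ((μ : ℤ) + 1))
      have h2 := dvd_add hd (dvd_refl ((μ : ℤ) + 1))
      have e : ((0 : ℕ) : ℤ) - (μ + 1 - r) + (μ + 1) = r - (0 : ℕ) := by push_cast; ring
      rwa [e] at h2) (by positivity) (by push_cast; omega)
    rw [← hr0]; rfl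
  · simp only [Nat.add_eq_zero_iff, one_ne_zero, and_false, Nat.add_sub_cancel, false_or] at h0
    by_cases hj' : j + 1 < N
    · have h1 := hlt hj'
      rcases cell_succ (s := s) hμ j with ⟨h2, h3⟩ | ⟨h2, h3, h4, h5, h6⟩
      · omega
      · have h7 : ((μ : ℤ) + 1) ∣ (r : ℤ) - (cellRow μ s j + 1 : ℕ) := by
          have h8 := dvd_cellContent_sub (μ := μ) (s := s) (j + 1)
          rw [h4] at h8
          have h9 := dvd_add (dvd_add h8 hd) (dvd_refl ((μ : ℤ) + 1))
          have e : -((cellRow μ s j : ℤ) + 1) - ((j + 1 : ℕ) : ℤ) + (((j + 1 : ℕ) : ℤ) - (μ + 1 - r))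
            + (μ + 1) = r - (cellRow μ s j + 1 : ℕ) := by push_cast; ring
          rwa [e] at h9
        have h10 : (r : ℤ) < μ + 1 + (cellRow μ s j + 1 : ℕ) := by push_cast; omega
        have h11 : ((cellRow μ s j + 1 : ℕ) : ℤ) ≤ r := by
          by_cases hz : cellRow μ s j = 0
          · rw [hz] at h7 ⊢
            by_contra hlt'
            have : r = 0 := by omega
            rw [this] at h7
            have := Int.le_of_dvd one_pos (by simpa using h7)
            omega
          · have := cellContent_le hμ hz
            push_cast; omega
        rw [h3, key _ h7 h11 h10]
    · have hjN' : j = s * μ + s + (l + 1) * μ + (ρ - 1) := by omega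
      have hrow : cellRow μ s j = l + 1 := by
        rw [hjN']; exact cellRow_rowStart_add hμ (by omega) (by omega)
      obtain ⟨c, hc, hjc, hcc⟩ := exists_column (μ := μ) (s := s) (j := j) hμ (by omega)
      rw [hrow] at hjc hcc
      have : c = ρ - 1 := by omega
      push_cast at hcc
      omega

end Crossings

section LexRank

variable {N : ℕ} {τ : Fin N → ℕ}

/-- The rank of `p` when the indices are sorted by the value of `τ`, ties being broken by
the order of the indices. -/
def lexRank (τ : Fin N → ℕ) (p : Fin N) : ℕ := #{q | τ q < τ p ∨ τ q = τ p ∧ q < p}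

lemma lexRank_lt_lexRank {p q : Fin N} (h : τ p < τ q ∨ τ p = τ q ∧ p < q) :
    lexRank τ p < lexRank τ q := by
  apply card_lt_card
  rw [ssubset_iff_of_subset]
  · exact ⟨p, by simpa using h, by simp⟩
  · intro a
    simp only [mem_filter, mem_univ, true_and]
    rcases h with h | ⟨h1, h2⟩ <;> rintro (h3 | ⟨h3, h4⟩)
    · left; omega
    · left; omega
    · left; omega
    · right; exact ⟨by omega, h4.trans h2⟩

lemma lexRank_lt_iff {p q : Fin N} :
    lexRank τ p < lexRank τ q ↔ τ p < τ q ∨ τ p = τ q ∧ p < q := by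
  refine ⟨fun h => ?_, lexRank_lt_lexRank⟩
  by_contra h'
  rcases lt_trichotomy (τ p) (τ q) with h1 | h1 | h1
  · exact h' (Or.inl h1)
  · rcases lt_trichotomy p q with h2 | h2 | h2
    · exact h' (Or.inr ⟨h1, h2⟩)
    · subst h2; omega
    · have := lexRank_lt_lexRank (Or.inr ⟨h1.symm, h2⟩); omega
  · have := lexRank_lt_lexRank (τ := τ) (Or.inl h1); omega

lemma lexRank_injective : Function.Injective (lexRank τ) := by
  intro p q h
  have h1 := (lexRank_lt_iff (τ := τ) (p := p) (q := q)).not.1 (by omega)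
  have h2 := (lexRank_lt_iff (τ := τ) (p := q) (q := p)).not.1 (by omega)
  push Not at h1 h2
  exact le_antisymm (h2.2 (by omega)) (h1.2 (by omega))

lemma lexRank_lt_card (p : Fin N) : lexRank τ p < N := by
  conv_rhs => rw [← Fintype.card_fin N, ← card_univ]
  apply card_lt_card
  rw [ssubset_iff_of_subset (subset_univ _)]
  exact ⟨p, mem_univ _, by simp⟩

lemma exists_lexRank_eq {j : ℕ} (hj : j < N) : ∃ p, lexRank τ p = j := by
  have h : Function.Injective fun p => (⟨lexRank τ p, lexRank_lt_card p⟩ : Fin N) :=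
    fun p q h => lexRank_injective (by simpa using h)
  obtain ⟨p, hp⟩ := Finite.surjective_of_injective h ⟨j, hj⟩
  exact ⟨p, by simpa using hp⟩

lemma lexRank_eq_self_of_monotone (h : Monotone τ) (p : Fin N) : lexRank τ p = p := by
  unfold lexRank
  have : ({q | τ q < τ p ∨ τ q = τ p ∧ q < p} : Finset (Fin N)) = Iio p := by
    ext q
    simp only [mem_filter, mem_univ, true_and, mem_Iio]
    constructor
    · rintro (h1 | h1)
      · exact h.reflect_lt h1
      · exact h1.2
    · intro h1
      rcases (h h1.le).lt_or_eq with h2 | h2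
      · exact Or.inl h2
      · exact Or.inr ⟨h2, h1⟩
  rw [this, Fin.card_Iio]

lemma lexRank_mul {m : ℕ} (hm : 1 ≤ m) (p : Fin N) :
    lexRank (fun i => m * τ i) p = lexRank τ p := by
  have h : 0 < m := hm
  simp [lexRank, Nat.mul_lt_mul_left h, h.ne']

/-- The word `w` listed in the order of increasing rank. -/
noncomputable def rankSeq (τ : Fin N → ℕ) (w : Fin N → ℤ) (j : ℕ) : ℤ :=
  open Classical in if h : ∃ p, lexRank τ p = j then w h.choose else 0

lemma rankSeq_lexRank (w : Fin N → ℤ) (p : Fin N) : rankSeq τ w (lexRank τ p) = w p := by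
  have h : ∃ q, lexRank τ q = lexRank τ p := ⟨p, rfl⟩
  rw [rankSeq, dif_pos h, lexRank_injective h.choose_spec]

/-- The index `p` does not continue the preceding index, in the order of ranks. -/
def IsRunStart (τ : Fin N → ℕ) (p : Fin N) : Prop :=
  ∀ q, lexRank τ q + 1 = lexRank τ p → τ q ≠ τ p

variable {n : ℕ} {w : Fin N → ℤ}

lemma pred_of_not_isRunStart (hR : ∀ p, (lexRank τ p : ℤ) = n * τ p + w p) {p : Fin N}
    (hp : ¬ IsRunStart τ p) :
    ∃ q, lexRank τ q + 1 = lexRank τ p ∧ τ q = τ p ∧ q < p ∧ w q + 1 = w p := by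
  unfold IsRunStart at hp
  push Not at hp
  obtain ⟨q, hq, hτ⟩ := hp
  have h1 := (lexRank_lt_iff (τ := τ) (p := q) (q := p)).1 (by omega)
  refine ⟨q, hq, hτ, by omega, ?_⟩
  have h2 := hR q
  have h3 := hR p
  rw [hτ] at h2
  omega

lemma IsRunStart.pred (hR : ∀ p, (lexRank τ p : ℤ) = n * τ p + w p) {p q : Fin N}
    (hp : IsRunStart τ p) (hq : lexRank τ q + 1 = lexRank τ p) : w p + n ≤ w q + 1 := by
  have h1 := (lexRank_lt_iff (τ := τ) (p := q) (q := p)).1 (by omega)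
  have h2 := hR q
  have h3 := hR p
  have h4 : τ q + 1 ≤ τ p := by have := hp q hq; omega
  have h5 : (n : ℤ) * (τ q + 1) ≤ n * τ p := by
    have : ((τ q + 1 : ℕ) : ℤ) ≤ τ p := by exact_mod_cast h4
    push_cast at this
    gcongr
  rw [mul_add, mul_one] at h5
  have : ((lexRank τ q : ℤ)) + 1 = lexRank τ p := by exact_mod_cast hq
  linarith

lemma IsRunStart.lexRank_mem_crossings
    (hR : ∀ p, (lexRank τ p : ℤ) = n * τ p + w p) {p : Fin N} (hp : IsRunStart τ p) {x : ℤ}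
    (hx : w p < x) (hx' : x ≤ w p + n) (hdvd : (n : ℤ) ∣ w p - x) :
    lexRank τ p ∈ crossings n N (rankSeq τ w) x := by
  simp only [crossings, mem_filter, mem_range]
  refine ⟨(lexRank_lt_card p).trans (Nat.lt_succ_self N), ?_, ?_, ?_⟩
  · rw [hR p, add_sub_assoc]
    exact dvd_add (dvd_mul_right _ _) hdvd
  · rcases Nat.eq_zero_or_pos (lexRank τ p) with h | h
    · exact Or.inl h
    · right
      obtain ⟨q, hq⟩ := exists_lexRank_eq (τ := τ) (j := lexRank τ p - 1)
        (by have := lexRank_lt_card (τ := τ) p; omega)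
      rw [← hq, rankSeq_lexRank]
      exact hx'.trans (hp.pred hR (by omega))
  · intro
    rw [rankSeq_lexRank]
    omega

lemma card_filter_rankSeq {P : ℤ → Prop} [DecidablePred P] {c : ℕ → ℤ} {π : Equiv.Perm (Fin N)}
    (hw : ∀ p, w p = c (π p)) :
    #{j ∈ range N | P (rankSeq τ w j)} = #{j ∈ range N | P (c j)} := by
  trans #{p : Fin N | P (w p)}
  · symm
    refine card_bij (fun p _ => lexRank τ p) ?_ (fun p _ q _ h => lexRank_injective h) ?_
    · intro p hp
      simpa [rankSeq_lexRank, lexRank_lt_card] using hp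
    · intro j hj
      simp only [mem_filter, mem_range] at hj
      obtain ⟨p, rfl⟩ := exists_lexRank_eq (τ := τ) hj.1
      exact ⟨p, by simpa [rankSeq_lexRank] using hj.2, rfl⟩
  · refine card_bij (fun p _ => (π p : ℕ)) ?_ ?_ ?_
    · intro p hp
      simpa [hw] using hp
    · intro p _ q _ h
      exact π.injective (Fin.ext h)
    · intro j hj
      simp only [mem_filter, mem_range] at hj
      exact ⟨π.symm ⟨j, hj.1⟩, by simpa [hw] using hj.2, by simp⟩

lemma dvd_rankSeq_sub (hR : ∀ p, (lexRank τ p : ℤ) = n * τ p + w p) {j : ℕ} (hj : j < N) :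
    (n : ℤ) ∣ rankSeq τ w j - j := by
  obtain ⟨p, rfl⟩ := exists_lexRank_eq (τ := τ) hj
  rw [rankSeq_lexRank, hR p]
  exact ⟨-τ p, by ring⟩

lemma rankSeq_succ_le (hR : ∀ p, (lexRank τ p : ℤ) = n * τ p + w p) {j : ℕ} (hj : j + 1 < N) :
    rankSeq τ w (j + 1) ≤ rankSeq τ w j + 1 := by
  obtain ⟨p, hp⟩ := exists_lexRank_eq (τ := τ) hj
  obtain ⟨q, rfl⟩ := exists_lexRank_eq (τ := τ) (Nat.lt_of_succ_lt hj)
  rw [← hp, rankSeq_lexRank, rankSeq_lexRank]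
  by_cases h : IsRunStart τ p
  · have := h.pred hR hp.symm
    omega
  · obtain ⟨q', hq', -, -, hw⟩ := pred_of_not_isRunStart hR h
    have : q' = q := lexRank_injective (τ := τ) (by omega)
    subst this
    omega

end LexRank

section Words

variable {μ s l ρ N : ℕ} {τ : Fin N → ℕ} {w : Fin N → ℤ} {π : Equiv.Perm (Fin N)}

lemma card_crossings_rankSeq_le_one (hμ : 1 ≤ μ) (hρ : 1 ≤ ρ) (hρμ : ρ ≤ μ)
    (hN : N = (s + l + 1) * μ + s + ρ) (hw : ∀ p, w p = cellContent μ s (π p))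
    (hR : ∀ p, (lexRank τ p : ℤ) = (μ + 1 : ℕ) * τ p + w p) {r : ℕ} (hr : r ≤ l + 1) :
    #(crossings (μ + 1) N (rankSeq τ w) ((μ : ℤ) + 1 - r)) ≤ 1 := by
  have h1 := card_crossings (n := μ + 1) (N := N) (C := rankSeq τ w) ((μ : ℤ) + 1 - r)
    (fun j hj => dvd_rankSeq_sub hR hj) (fun j hj => rankSeq_succ_le hR hj)
  have h2 := card_crossings (n := μ + 1) (N := N) (C := cellContent μ s) ((μ : ℤ) + 1 - r)
    (fun j _ => by exact_mod_cast dvd_cellContent_sub j)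
    (fun j _ => by
      rcases cell_succ (s := s) hμ j with ⟨-, h⟩ | ⟨-, -, h, h', -⟩ <;> omega)
  have h3 := card_crossings_cellContent hμ hρ hρμ hN hr
  have h4 := card_filter_rankSeq (τ := τ) hw
    (P := fun z => ((μ + 1 : ℕ) : ℤ) ∣ z - (μ + 1 - r) ∧ μ + 1 - r ≤ z)
  have h5 := card_filter_rankSeq (τ := τ) hw
    (P := fun z => ((μ + 1 : ℕ) : ℤ) ∣ z - (μ + 1 - r - 1) ∧ (μ : ℤ) + 1 - r - 1 ≤ z)
  omega

lemma cellContent_eq_of_le (hμ : 1 ≤ μ) {j : ℕ} (h : (μ : ℤ) ≤ cellContent μ s j) :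
    cellContent μ s j = j ∧ j < s * μ + s + μ := by
  have h0 : cellRow μ s j = 0 := by
    by_contra h0
    have := cellContent_le hμ h0
    omega
  exact ⟨cellContent_of_row_zero h0, cellRow_eq_zero_iff.1 h0⟩

lemma not_isRunStart_of_pos (hμ : 1 ≤ μ)
    (hN : N = (s + l + 1) * μ + s + ρ) (hw : ∀ p, w p = cellContent μ s (π p))
    (hR : ∀ p, (lexRank τ p : ℤ) = (μ + 1 : ℕ) * τ p + w p) (p : Fin N) (hp : 1 ≤ w p) :
    ¬ IsRunStart τ p := by
  have hN' : s * μ + s + μ ≤ N := by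
    have : (s + l + 1) * μ = s * μ + l * μ + μ := by ring
    omega
  have huniq : ∀ a b, (μ : ℤ) ≤ w a → w a = w b → a = b := by
    intro a b ha hab
    have hb := hab ▸ ha
    rw [hw] at ha hb
    rw [hw, hw, (cellContent_eq_of_le hμ ha).1, (cellContent_eq_of_le hμ hb).1] at hab
    exact π.injective (Fin.ext (by exact_mod_cast hab))
  intro hst
  classical
  obtain ⟨p, hpm, hmax⟩ := exists_max_image
    ({p | IsRunStart τ p ∧ 1 ≤ w p} : Finset (Fin N)) w ⟨p, by simp [hst, hp]⟩
  simp only [mem_filter, mem_univ, true_and, and_imp] at hpm hmax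
  obtain ⟨hst, hp⟩ := hpm
  have h0 : lexRank τ p ≠ 0 := by
    intro h0
    have := hR p
    have h1 : (0 : ℤ) ≤ (μ + 1 : ℕ) * τ p := by positivity
    omega
  obtain ⟨q, hq⟩ := exists_lexRank_eq (τ := τ) (j := lexRank τ p - 1)
    (by have := lexRank_lt_card (τ := τ) p; omega)
  have hq : lexRank τ q + 1 = lexRank τ p := by omega
  have hwq := hst.pred hR hq
  push_cast at hwq
  obtain ⟨hq1, hq2⟩ := cellContent_eq_of_le (s := s) (j := π q) hμ (by rw [← hw]; omega)
  rw [← hw] at hq1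
  by_cases hlast : (π q : ℕ) + 1 < s * μ + s + μ
  · set a : Fin N := π.symm ⟨π q + 1, by omega⟩ with ha
    have hwa : w a = w q + 1 := by
      rw [hw a, hq1, ha, Equiv.apply_symm_apply, cellContent_of_row_zero]
      · push_cast; rfl
      · rw [cellRow_eq_zero_iff]; exact hlast
    have : IsRunStart τ a := by
      by_contra hna
      obtain ⟨b, hb, -, -, hwb⟩ := pred_of_not_isRunStart hR hna
      have hbq : b = q := huniq b q (by omega) (by omega)
      subst hbq
      have : a = p := lexRank_injective (τ := τ) (by omega)
      rw [this] at hwa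
      omega
    have := hmax a this (by omega)
    omega
  · have hchain : ∀ i : ℕ, (i : ℤ) ≤ w q - w p →
        ∃ b, lexRank τ b + i = lexRank τ q ∧ w b + i = w q := by
      intro i
      induction i with
      | zero => exact fun _ => ⟨q, by simp⟩
      | succ i ih =>
        intro hi
        push_cast at hi
        obtain ⟨b, hb1, hb2⟩ := ih (by omega)
        have hnb : ¬ IsRunStart τ b := fun hb => by
          have := hmax b hb (by omega)
          omega
        obtain ⟨b', hb', -, -, hwb'⟩ := pred_of_not_isRunStart hR hnb
        exact ⟨b', by omega, by push_cast; omega⟩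
    obtain ⟨b, hb1, hb2⟩ := hchain (w q - w p).toNat (by omega)
    have hwb : w p = w b := by omega
    have hpq : (w p + 1) = (μ + 1 : ℕ) * ((s : ℤ) + 1 + τ q - τ p) := by
      have h1 := hR p
      have h2 := hR q
      have h3 : (π q : ℕ) + 1 = s * μ + s + μ := by omega
      have h4 : ((π q : ℕ) : ℤ) + 1 = s * μ + s + μ := by exact_mod_cast h3
      have h5 : (lexRank τ q : ℤ) + 1 = lexRank τ p := by exact_mod_cast hq
      push_cast at *
      linear_combination h2 - h1 - h5 + hq1 + h4
    have hle : ((μ + 1 : ℕ) : ℤ) ≤ w p + 1 := Int.le_of_dvd (by omega) ⟨_, hpq⟩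
    have : p = b := huniq p b (by push_cast at hle; omega) hwb
    subst this
    omega

/-- No exponent realizes the reading word of the contents with two neighbours in a row swapped. -/
lemma false_of_swap_row (hμ : 1 ≤ μ) (hρ : 1 ≤ ρ) (hρμ : ρ ≤ μ)
    (hN : N = (s + l + 1) * μ + s + ρ) {P Q : Fin N} (hPQ : (P : ℕ) + 1 = Q)
    (hrow : cellRow μ s P = cellRow μ s Q) (hl : cellRow μ s P ≤ l + 1)
    (hw : ∀ p, w p = cellContent μ s (Equiv.swap P Q p))
    (hR : ∀ p, (lexRank τ p : ℤ) = (μ + 1 : ℕ) * τ p + w p) : False := by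
  have hcQ : cellContent μ s Q = cellContent μ s P + 1 := by
    rcases cell_succ (s := s) hμ P with ⟨-, h⟩ | ⟨h, -⟩
    · rw [← hPQ, h]
    · rw [hPQ] at h; omega
  set v := cellContent μ s Q with hv
  have hwP : w P = v := by rw [hw, Equiv.swap_apply_left]
  have hwlt : ∀ p, p < P → w p = cellContent μ s p := by
    intro p hp
    rw [hw, Equiv.swap_apply_of_ne_of_ne hp.ne]
    rintro rfl
    have : (p : ℕ) < P := hp
    omega
  classical
  set X₁ : Finset (Fin N) := {p | p ≤ P ∧ w p = v} with hX₁
  set X₀ : Finset (Fin N) := {p | p ≤ P ∧ w p = v - 1} with hX₀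
  set Z : Finset (Fin N) :=
    {p | p < P ∧ w p = v ∧ cellContent μ s p = -(cellRow μ s p : ℤ) ∧
      (p : ℕ) = rowStart μ s (cellRow μ s p)} with hZ
  have hvrow : cellContent μ s Q = cellContent μ s P + 1 := by omega
  have hcard1 : #X₀ + (#Z + 1) ≤ #X₁ := by
    have hex : ∀ p ∈ X₀, ∃ q, q < P ∧ (p : ℕ) + 1 = q ∧ w q = v ∧ q ∉ Z := by
      intro p hp
      simp only [hX₀, mem_filter, mem_univ, true_and] at hp
      have hlt : p < P := lt_of_le_of_ne hp.1 (by rintro rfl; omega)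
      have hlt' : (p : ℕ) < P := hlt
      have hc := hwlt p hlt
      rcases cell_succ (s := s) hμ p with ⟨h1, h⟩ | ⟨h1, h2, h3, h4, h5⟩
      · have hne : (p : ℕ) + 1 ≠ P := by
          intro he
          rw [he] at h
          omega
        have hlt2 : (p : ℕ) + 1 < P := by omega
        refine ⟨⟨p + 1, by omega⟩, hlt2, rfl, ?_, ?_⟩
        · rw [hwlt _ hlt2, h]; omega
        · simp only [hZ, mem_filter, not_and]
          intro _ _ _ h7 h8
          have := neg_row_le_cellContent (s := s) hμ p
          omega
      · exfalso
        have hge : cellRow μ s p + 1 ≤ cellRow μ s Q := by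
          rw [← h1]; exact cellRow_mono (by omega)
        have := cellContent_le (s := s) (j := Q) hμ (by omega)
        omega
    choose! g hg1 hg2 hg3 hg4 using hex
    have hinj : Set.InjOn g X₀ := by
      intro a ha b hb hab
      have h1 := hg2 a ha
      have h2 := hg2 b hb
      rw [hab] at h1
      exact Fin.ext (by omega)
    have hPim : P ∉ X₀.image g := by
      intro h
      obtain ⟨a, ha, hga⟩ := mem_image.1 h
      exact (hg1 a ha).ne hga
    have hPZ : P ∉ Z := by simp [hZ]
    have hdisj : Disjoint (X₀.image g) Z := by
      rw [disjoint_left]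
      intro a ha
      obtain ⟨b, hb, rfl⟩ := mem_image.1 ha
      exact hg4 b hb
    rw [← card_image_of_injOn hinj, ← card_insert_of_notMem hPZ, ← card_union_of_disjoint]
    · apply card_le_card
      intro a ha
      rw [mem_union, mem_insert] at ha
      simp only [hX₁, mem_filter, mem_univ, true_and]
      rcases ha with ha | rfl | ha
      · obtain ⟨b, hb, rfl⟩ := mem_image.1 ha
        exact ⟨(hg1 b hb).le, hg3 b hb⟩
      · exact ⟨le_rfl, hwP⟩
      · simp only [hZ, mem_filter, mem_univ, true_and] at ha
        exact ⟨ha.1.le, ha.2.1⟩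
    · rw [disjoint_insert_right]
      exact ⟨hPim, hdisj⟩
  set St : Finset (Fin N) := X₁.filter (IsRunStart τ) with hSt
  have hcard2 : #X₁ ≤ #St + #X₀ := by
    rw [hSt, ← card_filter_add_card_filter_not (s := X₁) (IsRunStart τ)]
    refine Nat.add_le_add_left ?_ _
    have hex : ∀ p ∈ X₁.filter (fun p => ¬ IsRunStart τ p),
        ∃ q ∈ X₀, lexRank τ q + 1 = lexRank τ p := by
      intro p hp
      simp only [hX₁, mem_filter, mem_univ, true_and] at hp
      obtain ⟨q, h1, -, h2, h3⟩ := pred_of_not_isRunStart hR hp.2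
      refine ⟨q, ?_, h1⟩
      simp only [hX₀, mem_filter, mem_univ, true_and]
      exact ⟨h2.le.trans hp.1.1, by omega⟩
    choose! g hg1 hg2 using hex
    refine card_le_card_of_injOn g hg1 ?_
    intro a ha b hb hab
    have h1 := hg2 a ha
    have h2 := hg2 b hb
    rw [hab] at h1
    exact lexRank_injective (τ := τ) (by omega)
  by_cases hv1 : 1 ≤ v
  · obtain ⟨p, hp⟩ := card_pos.1 (show 0 < #St by omega)
    simp only [hSt, hX₁, mem_filter, mem_univ, true_and] at hp
    exact not_isRunStart_of_pos hμ hN hw hR p (by omega) hp.2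
  · have hPrl := neg_row_le_cellContent (s := s) hμ P
    obtain ⟨r, hr⟩ : ∃ r : ℕ, v = -(r : ℤ) := ⟨v.natAbs, by omega⟩
    have hrl : r + 1 ≤ cellRow μ s P := by omega
    have hrP : rowStart μ s r < P := by
      have h1 := (rowStart_le_iff (s := s) (r := r) (j := P) hμ).2 (by omega)
      refine lt_of_le_of_ne h1 fun h => ?_
      have := cellRow_rowStart (s := s) hμ r
      rw [h] at this
      omega
    have hZpos : 0 < #Z := by
      refine card_pos.2 ⟨⟨rowStart μ s r, hrP.trans P.2⟩, ?_⟩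
      simp only [hZ, mem_filter, mem_univ, true_and]
      have h1 := cellContent_rowStart (s := s) hμ r
      have h2 := cellRow_rowStart (s := s) hμ r
      refine ⟨hrP, ?_, ?_, ?_⟩
      · rw [hwlt _ hrP, h1, hr]
      · rw [h1, h2]
      · rw [h2]
    obtain ⟨a, ha, b, hb, hab⟩ := one_lt_card.1 (show 1 < #St by omega)
    simp only [hSt, hX₁, mem_filter, mem_univ, true_and] at ha hb
    have h1 := card_crossings_rankSeq_le_one hμ hρ hρμ hN hw hR (r := r) (by omega)
    have hmem : ∀ a, IsRunStart τ a → w a = v →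
        lexRank τ a ∈ crossings (μ + 1) N (rankSeq τ w) ((μ : ℤ) + 1 - r) := by
      intro a ha hwa
      apply ha.lexRank_mem_crossings hR
      · omega
      · push_cast; omega
      · rw [hwa, hr]; exact ⟨-1, by push_cast; ring⟩
    exact hab (lexRank_injective (card_le_one.1 h1 _ (hmem a ha.2 ha.1.2) _ (hmem b hb.2 hb.1.2)))

/-- If the reading word of the contents is modified by moving the first cell of row `r + 1` in
front of row `r`, then no exponent that is weakly increasing on these cells realizes it. -/
lemma false_of_cycle_row (hμ : 1 ≤ μ) (hρ : 1 ≤ ρ) (hρμ : ρ ≤ μ)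
    (hN : N = (s + l + 1) * μ + s + ρ) {r : ℕ} (hr : r ≤ l) {b k : Fin N}
    (hb : (b : ℕ) = rowStart μ s r) (hk : (k : ℕ) = rowStart μ s (r + 1))
    (hw : ∀ p, w p = cellContent μ s (π p))
    (hwlt : ∀ p, p < b → w p = cellContent μ s p) (hwgt : ∀ p, k < p → w p = cellContent μ s p)
    (hwb : w b = -((r : ℤ) + 1))
    (hwmid : ∀ p q : Fin N, b ≤ p → (p : ℕ) + 1 = q → q ≤ k → w q = cellContent μ s p)
    (hτ : ∀ p q : Fin N, b ≤ p → p ≤ q → q ≤ k → τ p ≤ τ q)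
    (hR : ∀ p, (lexRank τ p : ℤ) = (μ + 1 : ℕ) * τ p + w p) : False := by
  have hbk : (b : ℕ) < k := by
    by_contra h
    have := (rowStart_le_iff (s := s) (r := r + 1) (j := b) hμ).1 (by omega)
    rw [hb, cellRow_rowStart hμ] at this
    omega
  have hbk' : b ≤ k := hbk.le
  set e : Fin N := ⟨k - 1, by omega⟩ with he
  have hek : (e : ℕ) + 1 = k := by simp [he]; omega
  have hrowe : cellRow μ s e = r := by
    have h1 := (rowStart_le_iff (s := s) (r := r + 1) (j := e) hμ).not.1 (by omega)
    have h2 := (rowStart_le_iff (s := s) (r := r) (j := e) hμ).1 (by omega)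
    omega
  have hwk : w k = cellContent μ s e :=
    hwmid e k (show (b : ℕ) ≤ e by omega) hek le_rfl
  obtain ⟨hwk1, hwk2⟩ : (μ : ℤ) - 1 - r ≤ w k ∧ (r = 0 → w k = s * μ + s + μ - 1) := by
    rw [hwk]
    rcases cell_succ (s := s) hμ e with ⟨h1, -⟩ | ⟨-, -, -, h4, h5⟩
    · rw [hek, hk, cellRow_rowStart hμ, hrowe] at h1; omega
    · rw [hrowe] at h4 h5; exact ⟨h4, h5⟩
  have hwk3 : r ≠ 0 → w k = μ - 1 - r := fun h => by
    have := cellContent_le (s := s) (j := e) hμ (by omega)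
    rw [hrowe] at this; omega
  have hcard := card_crossings_rankSeq_le_one hμ hρ hρμ hN hw hR (r := r + 1) (by omega)
  have hstart : IsRunStart τ b := by
    by_contra h
    obtain ⟨q, -, -, hq, hwq⟩ := pred_of_not_isRunStart hR h
    rw [hwlt q hq, hwb] at hwq
    have h1 := neg_row_le_cellContent (s := s) hμ q
    have h2 : cellRow μ s q ≤ cellRow μ s b := cellRow_mono hq.le
    rw [hb, cellRow_rowStart hμ] at h2
    omega
  have hmem₁ : lexRank τ b ∈ crossings (μ + 1) N (rankSeq τ w) ((μ : ℤ) + 1 - (r + 1 : ℕ)) := by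
    apply hstart.lexRank_mem_crossings hR
    · rw [hwb]; push_cast; omega
    · rw [hwb]; push_cast; omega
    · rw [hwb]; exact ⟨-1, by push_cast; ring⟩
  have hrank : ∀ q, b ≤ q → q ≤ k → lexRank τ q ≤ lexRank τ k := by
    intro q h1 h2
    rcases h2.eq_or_lt with rfl | h2
    · exact le_rfl
    · refine (lexRank_lt_iff.2 ?_).le
      have := hτ q k h1 h2.le le_rfl
      omega
  have hmem₂ : lexRank τ k + 1 ∈
      crossings (μ + 1) N (rankSeq τ w) ((μ : ℤ) + 1 - (r + 1 : ℕ)) := by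
    simp only [crossings, mem_filter, mem_range]
    refine ⟨by have := lexRank_lt_card (τ := τ) k; omega, ?_, Or.inr ?_, ?_⟩
    · have h1 := hR k
      by_cases h0 : r = 0
      · rw [hwk2 h0] at h1
        subst h0
        refine ⟨τ k + s, ?_⟩
        push_cast at *
        rw [h1]; ring
      · rw [hwk3 h0] at h1
        refine ⟨τ k, ?_⟩
        push_cast at *
        rw [h1]; ring
    · rw [Nat.add_sub_cancel, rankSeq_lexRank]
      push_cast; omega
    · intro hlt
      obtain ⟨q, hq⟩ := exists_lexRank_eq (τ := τ) hlt
      rw [← hq, rankSeq_lexRank]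
      have hqout : ¬ (b ≤ q ∧ q ≤ k) := fun h => by
        have := hrank q h.1 h.2
        omega
      have hqs : IsRunStart τ q := by
        by_contra h
        obtain ⟨k', h1, -, h2, h3⟩ := pred_of_not_isRunStart hR h
        have : k' = k := lexRank_injective (τ := τ) (by omega)
        subst this
        rw [hwgt q h2] at h3
        have h4 : cellRow μ s k' ≤ cellRow μ s q := cellRow_mono h2.le
        rw [hk, cellRow_rowStart hμ] at h4
        have := cellContent_le (s := s) (j := q) hμ (by omega)
        omega
      have h1 := hqs.pred hR hq.symm
      push_cast at h1 ⊢
      by_cases h0 : r = 0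
      · by_contra hcon
        have hk2 := hwk2 h0
        have hb0 : (b : ℕ) = 0 := by rw [hb, h0]; rfl
        have hkq : k < q := by
          by_contra h
          exact hqout ⟨show (b : ℕ) ≤ q by omega, not_lt.1 h⟩
        rw [hwgt q hkq] at hcon
        have h4 : cellRow μ s k ≤ cellRow μ s q := cellRow_mono hkq.le
        rw [hk, cellRow_rowStart hμ] at h4
        have := cellContent_le (s := s) (j := q) hμ (by omega)
        omega
      · have := hwk3 h0
        omega
  have := card_le_one.1 hcard _ hmem₁ _ hmem₂
  have := hrank b le_rfl hbk'
  omega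

end Words

section Dunkl

variable {N : ℕ}

lemma X_sub_X_dvd_sub_rename_swap (i j : Fin N) (g : MvPolynomial (Fin N) ℚ) :
    X i - X j ∣ g - rename (Equiv.swap i j) g := by
  induction g using MvPolynomial.induction_on with
  | C a => simp
  | add p q hp hq =>
    rw [map_add, add_sub_add_comm]
    exact dvd_add hp hq
  | mul_X p k hp =>
    have h : (X i - X j : MvPolynomial (Fin N) ℚ) ∣ X k - X (Equiv.swap i j k) := by
      rcases eq_or_ne k i with rfl | hi
      · simp
      rcases eq_or_ne k j with rfl | hj
      · rw [Equiv.swap_apply_right, ← neg_sub]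
        exact dvd_neg.2 (dvd_refl _) |>.trans (by simp)
      · simp [Equiv.swap_apply_of_ne_of_ne hi hj]
    have h2 : p * X k - rename (Equiv.swap i j) (p * X k) =
        (p - rename (Equiv.swap i j) p) * X k +
          rename (Equiv.swap i j) p * (X k - X (Equiv.swap i j k)) := by
      rw [map_mul, rename_X]; ring
    rw [h2]
    exact dvd_add (hp.mul_right _) (h.mul_left _)

/-- The divided difference `Δ_{ij}`. -/
noncomputable def dividedDiff (i j : Fin N) : Module.End ℚ (MvPolynomial (Fin N) ℚ) :=
  (basisMonomials (Fin N) ℚ).constr ℚ fun α =>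
    (X_sub_X_dvd_sub_rename_swap i j (monomial α 1)).choose

lemma X_sub_X_mul_dividedDiff (i j : Fin N) (g : MvPolynomial (Fin N) ℚ) :
    (X i - X j) * dividedDiff i j g = g - rename (Equiv.swap i j) g := by
  suffices h : LinearMap.mulLeft ℚ (X i - X j : MvPolynomial (Fin N) ℚ) ∘ₗ dividedDiff i j =
      LinearMap.id - (rename (Equiv.swap i j)).toLinearMap from LinearMap.congr_fun h g
  refine (basisMonomials (Fin N) ℚ).ext fun α => ?_
  have := (X_sub_X_dvd_sub_rename_swap i j (monomial α (1 : ℚ))).choose_spec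
  simp only [LinearMap.comp_apply, LinearMap.mulLeft_apply, LinearMap.sub_apply, LinearMap.id_apply,
    AlgHom.toLinearMap_apply, dividedDiff, Module.Basis.constr_basis]
  rw [coe_basisMonomials]
  exact this.symm

lemma X_sub_X_ne_zero {i j : Fin N} (h : i ≠ j) : (X i - X j : MvPolynomial (Fin N) ℚ) ≠ 0 :=
  sub_ne_zero.2 fun e => h (X_injective e)

lemma eq_dividedDiff {i j : Fin N} (h : i ≠ j) {g q : MvPolynomial (Fin N) ℚ}
    (hq : (X i - X j) * q = g - rename (Equiv.swap i j) g) : q = dividedDiff i j g :=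
  mul_left_cancel₀ (X_sub_X_ne_zero h) (hq.trans (X_sub_X_mul_dividedDiff i j g).symm)

lemma dividedDiff_X_mul_of_ne {i j k : Fin N} (h : i ≠ j) (hi : k ≠ i) (hj : k ≠ j)
    (g : MvPolynomial (Fin N) ℚ) : dividedDiff i j (X k * g) = X k * dividedDiff i j g := by
  refine (eq_dividedDiff h ?_).symm
  rw [map_mul, rename_X, Equiv.swap_apply_of_ne_of_ne hi hj]
  linear_combination X k * X_sub_X_mul_dividedDiff i j g

lemma dividedDiff_X_left_mul {i j : Fin N} (h : i ≠ j) (g : MvPolynomial (Fin N) ℚ) :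
    dividedDiff i j (X i * g) = X i * dividedDiff i j g + rename (Equiv.swap i j) g := by
  refine (eq_dividedDiff h ?_).symm
  rw [map_mul, rename_X, Equiv.swap_apply_left]
  linear_combination X i * X_sub_X_mul_dividedDiff i j g

lemma dividedDiff_X_right_mul {i j : Fin N} (h : i ≠ j) (g : MvPolynomial (Fin N) ℚ) :
    dividedDiff i j (X j * g) = X j * dividedDiff i j g - rename (Equiv.swap i j) g := by
  refine (eq_dividedDiff h ?_).symm
  rw [map_mul, rename_X, Equiv.swap_apply_right]
  linear_combination X j * X_sub_X_mul_dividedDiff i j g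

lemma rename_comp_swap (σ : Equiv.Perm (Fin N)) (i j : Fin N) (g : MvPolynomial (Fin N) ℚ) :
    rename σ (rename (Equiv.swap i j) g) = rename (Equiv.swap (σ i) (σ j)) (rename σ g) := by
  rw [rename_rename, rename_rename]
  congr 2
  funext x
  simp [Equiv.swap_apply_def, apply_ite σ]

lemma rename_dividedDiff (σ : Equiv.Perm (Fin N)) {i j : Fin N} (h : i ≠ j)
    (g : MvPolynomial (Fin N) ℚ) :
    rename σ (dividedDiff i j g) = dividedDiff (σ i) (σ j) (rename σ g) := by
  refine eq_dividedDiff (σ.injective.ne h) ?_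
  rw [← rename_comp_swap, ← map_sub, ← X_sub_X_mul_dividedDiff]
  simp

/-- The Dunkl operator `D_i` with parameter `κ`. -/
noncomputable def dunkl (κ : ℚ) (i : Fin N) : Module.End ℚ (MvPolynomial (Fin N) ℚ) :=
  (pderiv i).toLinearMap + κ • ∑ j ∈ univ.erase i, dividedDiff i j

variable {κ : ℚ}

lemma dunkl_apply (i : Fin N) (g : MvPolynomial (Fin N) ℚ) :
    dunkl κ i g = pderiv i g + κ • ∑ j ∈ univ.erase i, dividedDiff i j g := by
  simp [dunkl]

lemma dunkl_one (i : Fin N) : dunkl κ i 1 = 0 := by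
  rw [dunkl_apply, sum_eq_zero]
  · simp
  · intro j hj
    exact (eq_dividedDiff (ne_of_mem_erase hj).symm (by simp)).symm

lemma rename_dunkl (σ : Equiv.Perm (Fin N)) (i : Fin N) (g : MvPolynomial (Fin N) ℚ) :
    rename σ (dunkl κ i g) = dunkl κ (σ i) (rename σ g) := by
  rw [dunkl_apply, dunkl_apply, map_add, map_smul, map_sum, pderiv_rename σ.injective]
  congr 2
  refine sum_bij (fun j _ => σ j) ?_ (fun _ _ _ _ h => σ.injective h) ?_ ?_
  · simp
  · intro b hb
    exact ⟨σ.symm b, by simpa [Equiv.symm_apply_eq] using hb, by simp⟩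
  · intro j hj
    exact rename_dividedDiff σ (ne_of_mem_erase hj).symm g

lemma dunkl_X_mul_of_ne {i k : Fin N} (h : k ≠ i) (g : MvPolynomial (Fin N) ℚ) :
    dunkl κ i (X k * g) = X k * dunkl κ i g - κ • rename (Equiv.swap i k) g := by
  have hk : k ∈ univ.erase i := by simpa using h
  rw [dunkl_apply, dunkl_apply, Derivation.leibniz, pderiv_X_of_ne h, ← add_sum_erase _ _ hk,
    ← add_sum_erase _ _ hk, dividedDiff_X_right_mul h.symm,
    sum_congr rfl fun j hj => dividedDiff_X_mul_of_ne (ne_of_mem_erase (mem_of_mem_erase hj)).symm h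
      (ne_of_mem_erase hj).symm g, ← mul_sum]
  simp only [smul_eq_C_mul, smul_eq_mul]
  ring

lemma dunkl_X_mul_self (i : Fin N) (g : MvPolynomial (Fin N) ℚ) :
    dunkl κ i (X i * g) = X i * dunkl κ i g + g +
      κ • ∑ j ∈ univ.erase i, rename (Equiv.swap i j) g := by
  rw [dunkl_apply, dunkl_apply, Derivation.leibniz, pderiv_X_self,
    sum_congr rfl fun j hj => dividedDiff_X_left_mul (ne_of_mem_erase hj).symm g, sum_add_distrib,
    ← mul_sum]
  simp only [smul_eq_C_mul, smul_eq_mul]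
  ring

lemma rename_swap_dunkl_of_ne {i j k : Fin N} (hi : k ≠ i) (hj : k ≠ j)
    (g : MvPolynomial (Fin N) ℚ) :
    rename (Equiv.swap i j) (dunkl κ k g) = dunkl κ k (rename (Equiv.swap i j) g) := by
  rw [rename_dunkl, Equiv.swap_apply_of_ne_of_ne hi hj]

lemma dunkl_commutator_X_left_mul {i j : Fin N} (h : i ≠ j) (g : MvPolynomial (Fin N) ℚ) :
    dunkl κ i (dunkl κ j (X i * g)) - dunkl κ j (dunkl κ i (X i * g)) =
      X i * (dunkl κ i (dunkl κ j g) - dunkl κ j (dunkl κ i g)) := by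
  have hj : j ∈ univ.erase i := by simpa using h.symm
  rw [dunkl_X_mul_of_ne h, dunkl_X_mul_self, map_sub, map_add, map_add, dunkl_X_mul_self,
    dunkl_X_mul_of_ne h, map_smul, map_smul, map_sum, ← add_sum_erase _ _ hj,
    ← add_sum_erase _ _ hj, rename_dunkl, rename_dunkl, Equiv.swap_apply_right,
    Equiv.swap_apply_right, Equiv.swap_comm j i,
    sum_congr rfl fun l hl => rename_swap_dunkl_of_ne (κ := κ) h.symm (ne_of_mem_erase hl).symm g]
  simp only [smul_eq_C_mul]
  ring

lemma dunkl_commutator_X_mul {i j : Fin N} (h : i ≠ j) (k : Fin N) (g : MvPolynomial (Fin N) ℚ) :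
    dunkl κ i (dunkl κ j (X k * g)) - dunkl κ j (dunkl κ i (X k * g)) =
      X k * (dunkl κ i (dunkl κ j g) - dunkl κ j (dunkl κ i g)) := by
  rcases eq_or_ne k i with rfl | hi
  · exact dunkl_commutator_X_left_mul h g
  rcases eq_or_ne k j with rfl | hj
  · linear_combination -dunkl_commutator_X_left_mul (κ := κ) h.symm g
  · rw [dunkl_X_mul_of_ne hi, dunkl_X_mul_of_ne hj, map_sub, map_sub, dunkl_X_mul_of_ne hi,
      dunkl_X_mul_of_ne hj, map_smul, map_smul, rename_swap_dunkl_of_ne h hi.symm,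
      rename_swap_dunkl_of_ne h.symm hj.symm]
    ring

theorem dunkl_comm (i j : Fin N) (g : MvPolynomial (Fin N) ℚ) :
    dunkl κ i (dunkl κ j g) = dunkl κ j (dunkl κ i g) := by
  rcases eq_or_ne i j with rfl | h
  · rfl
  rw [← sub_eq_zero]
  induction g using MvPolynomial.induction_on with
  | C a =>
    rw [C_eq_smul_one]
    simp [dunkl_one]
  | add p q hp hq =>
    simp only [map_add]
    rw [add_sub_add_comm, hp, hq, add_zero]
  | mul_X p k hp => rw [mul_comm, dunkl_commutator_X_mul h, hp, mul_zero]

/-- The Cherednik operator `x_i D_i + κ ∑_{j < i} (i, j)`. -/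
noncomputable def cherednik (κ : ℚ) (i : Fin N) : Module.End ℚ (MvPolynomial (Fin N) ℚ) :=
  LinearMap.mulLeft ℚ (X i) ∘ₗ dunkl κ i +
    κ • ∑ j ∈ Iio i, (rename (Equiv.swap i j)).toLinearMap

lemma cherednik_apply (i : Fin N) (g : MvPolynomial (Fin N) ℚ) :
    cherednik κ i g = X i * dunkl κ i g + κ • ∑ j ∈ Iio i, rename (Equiv.swap i j) g := by
  simp [cherednik]

lemma rename_sum_swap {σ : Equiv.Perm (Fin N)} {i : Fin N} (hi : σ i = i)
    (hσ : ∀ j, σ j < i ↔ j < i) (g : MvPolynomial (Fin N) ℚ) :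
    rename σ (∑ j ∈ Iio i, rename (Equiv.swap i j) g) =
      ∑ j ∈ Iio i, rename (Equiv.swap i j) (rename σ g) := by
  rw [map_sum]
  refine sum_bij (fun j _ => σ j) ?_ (fun _ _ _ _ h => σ.injective h) ?_ ?_
  · simp [hσ]
  · intro b hb
    refine ⟨σ.symm b, ?_, by simp⟩
    rw [mem_Iio, ← hσ]
    simpa using hb
  · intro j _
    rw [rename_comp_swap, hi]

lemma rename_cherednik {σ : Equiv.Perm (Fin N)} {i : Fin N} (hi : σ i = i)
    (hσ : ∀ j, σ j < i ↔ j < i) (g : MvPolynomial (Fin N) ℚ) :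
    rename σ (cherednik κ i g) = cherednik κ i (rename σ g) := by
  rw [cherednik_apply, cherednik_apply, map_add, map_smul, map_mul, rename_X, rename_dunkl,
    rename_sum_swap hi hσ, hi]

lemma swap_lt_iff {a b i : Fin N} (h : a < i ↔ b < i) (j : Fin N) :
    Equiv.swap a b j < i ↔ j < i := by
  rw [Equiv.swap_apply_def]
  split_ifs with h1 h2
  · rw [h1, h]
  · rw [h2, h]
  · rfl

lemma rename_swap_cherednik {a b i : Fin N} (ha : i ≠ a) (hb : i ≠ b) (h : a < i ↔ b < i)
    (g : MvPolynomial (Fin N) ℚ) :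
    rename (Equiv.swap a b) (cherednik κ i g) = cherednik κ i (rename (Equiv.swap a b) g) :=
  rename_cherednik (Equiv.swap_apply_of_ne_of_ne ha hb) (swap_lt_iff h) g

lemma X_mul_dunkl_cherednik {i j : Fin N} (h : i < j) (g : MvPolynomial (Fin N) ℚ) :
    X i * dunkl κ i (cherednik κ j g) = cherednik κ j (X i * dunkl κ i g) := by
  have hi : i ∈ Iio j := by simpa using h
  rw [cherednik_apply, cherednik_apply, map_add, map_smul, map_sum, dunkl_X_mul_of_ne h.ne',
    dunkl_X_mul_of_ne h.ne, dunkl_comm j i, ← add_sum_erase _ _ hi, ← add_sum_erase _ _ hi,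
    sum_congr rfl fun l hl => (rename_swap_dunkl_of_ne (κ := κ) h.ne
      (ne_of_mem_erase hl).symm g).symm,
    sum_congr rfl fun l hl => show rename (Equiv.swap j l) (X i * dunkl κ i g) =
      X i * rename (Equiv.swap j l) (dunkl κ i g) by
        rw [map_mul, rename_X, Equiv.swap_apply_of_ne_of_ne h.ne (ne_of_mem_erase hl).symm],
    ← mul_sum, map_mul, rename_X, rename_dunkl, rename_dunkl, Equiv.swap_comm j i,
    Equiv.swap_apply_left, Equiv.swap_apply_right]
  simp only [smul_eq_C_mul]
  ring

theorem cherednik_comm (i j : Fin N) (g : MvPolynomial (Fin N) ℚ) :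
    cherednik κ i (cherednik κ j g) = cherednik κ j (cherednik κ i g) := by
  wlog h : i < j generalizing i j
  · rcases eq_or_lt_of_not_gt h with rfl | h
    · rfl
    · exact (this j i h).symm
  rw [cherednik_apply i, cherednik_apply i, map_add, map_smul, map_sum, X_mul_dunkl_cherednik h]
  congr 2
  refine sum_congr rfl fun k hk => ?_
  have hk : k < j := (mem_Iio.1 hk).trans h
  exact rename_swap_cherednik h.ne' hk.ne' (by simp [h, hk]) g

/-- Intertwining relation of an adjacent transposition. -/
lemma cherednik_swap_succ {p q : Fin N} (h : (p : ℕ) + 1 = q) (g : MvPolynomial (Fin N) ℚ) :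
    cherednik κ q (rename (Equiv.swap p q) g) =
      rename (Equiv.swap p q) (cherednik κ p g) + κ • g := by
  have hIio : Iio q = insert p (Iio p) := by
    ext x
    rw [mem_insert, mem_Iio, mem_Iio, Fin.ext_iff, Fin.lt_def, Fin.lt_def]
    omega
  have hpq : p ≠ q := fun e => by rw [e] at h; omega
  rw [cherednik_apply, cherednik_apply, map_add, map_smul, map_sum, map_mul, rename_X, rename_dunkl,
    Equiv.swap_apply_left, hIio, sum_insert (by simp), Equiv.swap_comm q p, rename_rename,
    sum_congr rfl fun j hj => show rename (Equiv.swap p q) (rename (Equiv.swap p j) g) =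
      rename (Equiv.swap q j) (rename (Equiv.swap p q) g) by
        have hj : j < p := mem_Iio.1 hj
        rw [rename_comp_swap, Equiv.swap_apply_left, Equiv.swap_apply_of_ne_of_ne hj.ne
          (fun e => by rw [e, Fin.lt_def] at hj; omega)]]
  rw [← Equiv.coe_trans, Equiv.swap_swap, smul_add]
  simp only [Equiv.coe_refl, rename_id, AlgHom.id_apply]
  ring

end Dunkl

section Triangularity

variable {N : ℕ} {κ : ℚ}

/-- The order on exponents for which the Cherednik operators are triangular. -/
def expHeight (α : Fin N →₀ ℕ) : ℕ := ∑ i : Fin N, (N * α i ^ 2 + i * α i)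

/-- Polynomials all of whose monomials have the degree of `α` and a smaller height. -/
noncomputable def lowerTerms (α : Fin N →₀ ℕ) : Submodule ℚ (MvPolynomial (Fin N) ℚ) :=
  restrictSupport ℚ {β | β.degree = α.degree ∧ expHeight β < expHeight α}

lemma monomial_mem_lowerTerms {α β : Fin N →₀ ℕ} (h : β.degree = α.degree)
    (h' : expHeight β < expHeight α) : monomial β (1 : ℚ) ∈ lowerTerms α :=
  (monomial_mem_restrictSupport ℚ).2 (Or.inl ⟨h, h'⟩)

lemma sum_add_eq_of_eq_off {i j : Fin N} (hij : i ≠ j) {u v : Fin N → ℕ}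
    (h : ∀ k, k ≠ i → k ≠ j → u k = v k) :
    ∑ k, u k + (v i + v j) = ∑ k, v k + (u i + u j) := by
  have hj : j ∈ univ.erase i := by simpa using hij.symm
  rw [← add_sum_erase _ _ (mem_univ i), ← add_sum_erase _ _ hj, ← add_sum_erase _ v (mem_univ i),
    ← add_sum_erase _ v hj, sum_congr rfl fun k hk =>
      h k (ne_of_mem_erase (mem_of_mem_erase hk)) (ne_of_mem_erase hk)]
  ring

lemma degree_eq_of_eq_off {i j : Fin N} (hij : i ≠ j) {α β : Fin N →₀ ℕ}
    (h : ∀ k, k ≠ i → k ≠ j → β k = α k) (hs : β i + β j = α i + α j) : β.degree = α.degree := by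
  rw [Finsupp.degree_eq_sum, Finsupp.degree_eq_sum]
  have := sum_add_eq_of_eq_off hij h
  omega

lemma expHeight_lt_of_between {i j : Fin N} (hij : i ≠ j) {α β : Fin N →₀ ℕ}
    (h : ∀ k, k ≠ i → k ≠ j → β k = α k) (hs : β i + β j = α i + α j)
    (hb : α j < β i ∧ β i < α i ∨ α i < β i ∧ β i < α j) : expHeight β < expHeight α := by
  have h1 := sum_add_eq_of_eq_off (u := fun k : Fin N => N * β k ^ 2 + k * β k)
    (v := fun k : Fin N => N * α k ^ 2 + k * α k) hij (fun k h1 h2 => by simp only [h k h1 h2])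
  change expHeight β + _ = expHeight α + _ at h1
  have hi : (i : ℤ) + 1 ≤ N := by exact_mod_cast i.2
  have hj : (j : ℤ) + 1 ≤ N := by exact_mod_cast j.2
  have hi0 : (0 : ℤ) ≤ i := by positivity
  have hj0 : (0 : ℤ) ≤ j := by positivity
  zify at h1 hs hb ⊢
  have hβj : (β j : ℤ) = α i + α j - β i := by linarith
  rw [hβj] at h1
  suffices (0 : ℤ) < 2 * N * ((α i - β i) * (β i - α j)) + (i - j) * (α i - β i) by nlinarith
  rcases hb with ⟨h2, h3⟩ | ⟨h2, h3⟩
  · nlinarith [mul_nonneg (sub_nonneg.2 (Int.add_one_le_of_lt h3))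
      (sub_nonneg.2 (Int.add_one_le_of_lt h2)), mul_pos (sub_pos.2 h3) (sub_pos.2 h2)]
  · nlinarith [mul_nonneg (sub_nonneg.2 (Int.add_one_le_of_lt h3))
      (sub_nonneg.2 (Int.add_one_le_of_lt h2)), mul_pos (sub_pos.2 h3) (sub_pos.2 h2)]

lemma mapDomain_swap_apply (i j : Fin N) (α : Fin N →₀ ℕ) (k : Fin N) :
    α.mapDomain (Equiv.swap i j) k = α (Equiv.swap i j k) := by
  rw [Finsupp.mapDomain_equiv_apply, Equiv.symm_swap]

lemma mapDomain_swap_eq_off {i j : Fin N} (α : Fin N →₀ ℕ) (k : Fin N) (hi : k ≠ i)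
    (hj : k ≠ j) : α.mapDomain (Equiv.swap i j) k = α k := by
  rw [mapDomain_swap_apply, Equiv.swap_apply_of_ne_of_ne hi hj]

lemma degree_mapDomain_swap {i j : Fin N} (hij : i ≠ j) (α : Fin N →₀ ℕ) :
    (α.mapDomain (Equiv.swap i j)).degree = α.degree :=
  degree_eq_of_eq_off hij (mapDomain_swap_eq_off α) (by simp [add_comm])

lemma expHeight_mapDomain_swap_lt {i j : Fin N} {α : Fin N →₀ ℕ} (hij : i < j)
    (h : α i < α j) : expHeight (α.mapDomain (Equiv.swap i j)) < expHeight α := by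
  have h1 := sum_add_eq_of_eq_off
    (u := fun k : Fin N => N * (α.mapDomain (Equiv.swap i j)) k ^ 2 +
      k * (α.mapDomain (Equiv.swap i j)) k)
    (v := fun k : Fin N => N * α k ^ 2 + k * α k) hij.ne
    (fun k h1 h2 => by simp only [mapDomain_swap_eq_off α k h1 h2])
  change expHeight _ + _ = expHeight α + _ at h1
  simp only [mapDomain_swap_apply, Equiv.swap_apply_left, Equiv.swap_apply_right] at h1
  have hij' : (i : ℕ) < j := hij
  nlinarith [Nat.mul_le_mul hij'.le h.le]

/-- The exponent obtained by moving `t` from the `i`-th to the `j`-th entry. -/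
noncomputable def transferExp (α : Fin N →₀ ℕ) (i j : Fin N) (t : ℕ) : Fin N →₀ ℕ :=
  α - Finsupp.single i t + Finsupp.single j t

lemma dividedDiff_monomial {i j : Fin N} (hij : i ≠ j) {α : Fin N →₀ ℕ} (h : α j ≤ α i) :
    X i * dividedDiff i j (monomial α (1 : ℚ)) =
      ∑ t ∈ range (α i - α j), monomial (transferExp α i j t) 1 := by
  have hq : ∑ t ∈ range (α i - α j),
      monomial (α - Finsupp.single i (t + 1) + Finsupp.single j t) (1 : ℚ) =
        dividedDiff i j (monomial α 1) := by
    refine eq_dividedDiff hij ?_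
    have htel := sum_range_sub' (fun t => monomial (transferExp α i j t) (1 : ℚ)) (α i - α j)
    rw [rename_monomial]
    have h0 : transferExp α i j 0 = α := by simp [transferExp]
    have hd : transferExp α i j (α i - α j) = α.mapDomain (Equiv.swap i j) := by
      ext k
      rw [mapDomain_swap_apply]
      rcases eq_or_ne k i with rfl | hi
      · simp [transferExp, hij]; omega
      rcases eq_or_ne k j with rfl | hj
      · simp [transferExp, hij.symm]; omega
      · simp [transferExp, Equiv.swap_apply_of_ne_of_ne hi hj, hi, hj]
    rw [h0, hd] at htel
    rw [← htel, mul_sum]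
    refine sum_congr rfl fun t ht => ?_
    have ht : t < α i - α j := mem_range.1 ht
    rw [sub_mul, X, X, monomial_mul, monomial_mul, one_mul]
    congr 3
    · ext k
      rcases eq_or_ne k i with rfl | hi
      · simp [transferExp, hij]; omega
      · simp [transferExp, hi]
    · ext k
      rcases eq_or_ne k j with rfl | hj
      · simp [transferExp, hij.symm]; omega
      · simp [transferExp, hj]
  rw [← hq, mul_sum]
  refine sum_congr rfl fun t ht => ?_
  have ht : t < α i - α j := mem_range.1 ht
  rw [X, monomial_mul, one_mul]
  congr 2
  ext k
  rcases eq_or_ne k i with rfl | hi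
  · simp [transferExp, hij]; omega
  · simp [transferExp, hi]

lemma dividedDiff_monomial_sub_mem {i j : Fin N} (hij : i ≠ j) {α γ : Fin N →₀ ℕ}
    (h : α j < α i) (hoff : ∀ k, k ≠ i → k ≠ j → α k = γ k) (hs : α i + α j = γ i + γ j)
    (hγ : γ i = α i ∨ γ i = α j) :
    X i * dividedDiff i j (monomial α (1 : ℚ)) - monomial α 1 ∈ lowerTerms γ := by
  obtain ⟨d, hd⟩ := Nat.exists_eq_add_of_lt h
  rw [dividedDiff_monomial hij h.le, show α i - α j = d + 1 by omega, sum_range_succ']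
  have h0 : transferExp α i j 0 = α := by simp [transferExp]
  rw [h0, add_sub_cancel_right]
  refine Submodule.sum_mem _ fun t ht => ?_
  have ht : t < d := mem_range.1 ht
  have hti : transferExp α i j (t + 1) i = α i - (t + 1) := by simp [transferExp, hij]
  have htj : transferExp α i j (t + 1) j = α j + (t + 1) := by simp [transferExp, hij.symm]
  have hoff' : ∀ k, k ≠ i → k ≠ j → transferExp α i j (t + 1) k = γ k := fun k hi hj => by
    rw [← hoff k hi hj]
    simp [transferExp, hi, hj]
  refine monomial_mem_lowerTerms (degree_eq_of_eq_off hij hoff' (by omega))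
    (expHeight_lt_of_between hij hoff' (by omega) (by omega))

lemma dividedDiff_rename_swap {i j : Fin N} (hij : i ≠ j) (g : MvPolynomial (Fin N) ℚ) :
    dividedDiff i j (rename (Equiv.swap i j) g) = -dividedDiff i j g := by
  refine (eq_dividedDiff hij ?_).symm
  rw [rename_rename, ← Equiv.coe_trans, Equiv.swap_swap]
  simp only [Equiv.coe_refl, rename_id, AlgHom.id_apply]
  linear_combination -X_sub_X_mul_dividedDiff i j g

lemma cherednik_term_mem {i j : Fin N} (hij : i ≠ j) (α : Fin N →₀ ℕ) :
    X i * dividedDiff i j (monomial α (1 : ℚ)) +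
        (if j < i then rename (Equiv.swap i j) (monomial α (1 : ℚ)) else 0) -
      (if α j < α i ∨ α j = α i ∧ j < i then monomial α 1 else 0) ∈ lowerTerms α := by
  rcases lt_trichotomy (α j) (α i) with h | h | h
  · have h1 := dividedDiff_monomial_sub_mem hij h (fun _ _ _ => rfl) rfl (Or.inl rfl)
    rw [if_pos (Or.inl h)]
    split_ifs with hji
    · rw [add_sub_right_comm, rename_monomial, Equiv.swap_comm]
      exact add_mem h1 (monomial_mem_lowerTerms (degree_mapDomain_swap hij.symm α)
        (expHeight_mapDomain_swap_lt hji h))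
    · rwa [add_zero]
  · have hswap : α.mapDomain (Equiv.swap i j) = α := by
      ext k
      rw [mapDomain_swap_apply, Equiv.swap_apply_def]
      split_ifs with h1 h2
      · rw [h1, h]
      · rw [h2, h]
      · rfl
    rw [dividedDiff_monomial hij h.le, rename_monomial, hswap, h]
    simp
  · have h1 := dividedDiff_monomial_sub_mem (α := α.mapDomain (Equiv.swap i j)) (γ := α) hij
      (by simpa [mapDomain_swap_apply] using h) (mapDomain_swap_eq_off α)
      (by simp [add_comm]) (by simp)
    rw [← rename_monomial, dividedDiff_rename_swap hij] at h1
    have hneg : ¬(α j < α i ∨ α j = α i ∧ j < i) := fun h2 => h2.elim h.not_gt fun h2 => h.ne' h2.1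
    rw [if_neg hneg, sub_zero]
    rw [← neg_mem_iff] at h1
    split_ifs with hji
    · convert h1 using 1; ring
    · have hij' : i < j := lt_of_le_of_ne (not_lt.1 hji) hij
      have h2 : rename (Equiv.swap i j) (monomial α (1 : ℚ)) ∈ lowerTerms α := by
        rw [rename_monomial]
        exact monomial_mem_lowerTerms (degree_mapDomain_swap hij α)
          (expHeight_mapDomain_swap_lt hij' h)
      convert sub_mem h1 h2 using 1; ring

lemma cherednik_monomial_sub_mem (i : Fin N) (α : Fin N →₀ ℕ) :
    cherednik κ i (monomial α (1 : ℚ)) - ((α i : ℚ) + κ * lexRank α i) • monomial α (1 : ℚ) ∈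
      lowerTerms α := by
  have hpd : X i * pderiv i (monomial α (1 : ℚ)) = (α i : ℚ) • monomial α (1 : ℚ) := by
    rw [X_mul_pderiv_monomial, Nat.cast_smul_eq_nsmul]
  have hIio : ∑ j ∈ Iio i, rename (Equiv.swap i j) (monomial α (1 : ℚ)) =
      ∑ j ∈ univ.erase i,
        if j < i then rename (Equiv.swap i j) (monomial α (1 : ℚ)) else 0 := by
    rw [← sum_filter]
    congr 1
    ext j
    simp only [mem_Iio, mem_filter, mem_erase, mem_univ, and_true]
    exact ⟨fun h => ⟨h.ne, h⟩, fun h => h.2⟩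
  have hrank : (lexRank α i : ℚ) • monomial α (1 : ℚ) =
      ∑ j ∈ univ.erase i, if α j < α i ∨ α j = α i ∧ j < i then monomial α (1 : ℚ) else 0 := by
    rw [← sum_filter, sum_const, Nat.cast_smul_eq_nsmul, lexRank]
    congr 2
    ext j
    simp only [mem_filter, mem_erase, mem_univ, and_true, true_and]
    refine ⟨fun h => ⟨?_, h⟩, fun h => h.2⟩
    rintro rfl
    simp at h
  have key : κ • ∑ j ∈ univ.erase i, (X i * dividedDiff i j (monomial α (1 : ℚ)) +
        (if j < i then rename (Equiv.swap i j) (monomial α (1 : ℚ)) else 0) -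
      (if α j < α i ∨ α j = α i ∧ j < i then monomial α 1 else 0)) ∈ lowerTerms α :=
    Submodule.smul_mem _ _ <| Submodule.sum_mem _ fun j hj =>
      cherednik_term_mem (ne_of_mem_erase hj).symm α
  rw [sum_sub_distrib, sum_add_distrib, ← hrank, ← hIio, ← mul_sum] at key
  convert key using 1
  rw [cherednik_apply, dunkl_apply, mul_add, hpd]
  simp only [smul_eq_C_mul, map_add, map_mul]
  ring

lemma coeff_eq_zero_of_mem_lowerTerms {α β : Fin N →₀ ℕ} {g : MvPolynomial (Fin N) ℚ}
    (hg : g ∈ lowerTerms α) (h : expHeight α ≤ expHeight β) : coeff β g = 0 := by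
  by_contra hne
  exact h.not_gt (((mem_restrictSupport_iff ℚ).1 hg) (mem_support_iff.2 hne)).2

/-- The coefficient at an exponent of maximal height is multiplied by a scalar. -/
lemma coeff_cherednik (i : Fin N) {β : Fin N →₀ ℕ} {g : MvPolynomial (Fin N) ℚ}
    (h : ∀ α ∈ g.support, expHeight α ≤ expHeight β) :
    coeff β (cherednik κ i g) = ((β i : ℚ) + κ * lexRank β i) * coeff β g := by
  conv_lhs => rw [g.as_sum, map_sum, coeff_sum]
  have hterm : ∀ α ∈ g.support, coeff β (cherednik κ i (monomial α (coeff α g))) =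
      ((β i : ℚ) + κ * lexRank β i) * coeff β (monomial α (coeff α g)) := by
    intro α hα
    have h1 := coeff_eq_zero_of_mem_lowerTerms (cherednik_monomial_sub_mem (κ := κ) i α) (h α hα)
    rw [coeff_sub, sub_eq_zero, coeff_smul, smul_eq_mul] at h1
    have h2 : monomial α (coeff α g) = coeff α g • monomial α (1 : ℚ) := by
      rw [smul_monomial, smul_eq_mul, mul_one]
    rw [h2, map_smul, coeff_smul, h1, coeff_smul, smul_eq_mul, smul_eq_mul]
    rcases eq_or_ne α β with rfl | hne
    · ring
    · simp [coeff_monomial, hne]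
  rw [sum_congr rfl hterm, ← mul_sum, ← coeff_sum, ← g.as_sum]

/-- A joint eigenvector has the eigenvalues of each of its exponents of maximal height. -/
lemma eigenvalue_eq_of_max {g : MvPolynomial (Fin N) ℚ} {η : ℚ} {i : Fin N}
    (hg : cherednik κ i g = η • g) {β : Fin N →₀ ℕ} (hβ : β ∈ g.support)
    (h : ∀ α ∈ g.support, expHeight α ≤ expHeight β) : η = β i + κ * lexRank β i := by
  have h1 := coeff_cherednik (κ := κ) i h
  rw [hg, coeff_smul, smul_eq_mul] at h1
  exact mul_right_cancel₀ (mem_support_iff.1 hβ) h1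

end Triangularity

section JointEigenvector

variable {K V ι : Type*} [Field K] [AddCommGroup V] [Module K V] [FiniteDimensional K V]
  [Fintype ι]

/-- Commuting endomorphisms killed by a nonzero functional have a common kernel vector. -/
lemma exists_common_kernel (B : ι → Module.End K V) (hB : ∀ i j, Commute (B i) (B j))
    (φ : V →ₗ[K] K) (hφ : φ ≠ 0) (hφB : ∀ i v, φ (B i v) = 0) :
    ∃ v, v ≠ 0 ∧ ∀ i, B i v = 0 := by
  classical
  have hcomm : ∀ (i j : ι) (a b : ℕ) (v : V), (B i ^ a) ((B j ^ b) v) = (B j ^ b) ((B i ^ a) v) :=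
    fun i j a b v => LinearMap.congr_fun ((hB i j).pow_pow a b).eq v
  have exists_nilpotent : ∀ S : Finset ι, ∃ v, φ v ≠ 0 ∧ ∀ i ∈ S, ∃ n, (B i ^ n) v = 0 := by
    intro S
    induction S using Finset.induction_on with
    | empty =>
      obtain ⟨v, hv⟩ := DFunLike.ne_iff.1 hφ
      exact ⟨v, hv, by simp⟩
    | insert i S _ ih =>
      obtain ⟨v, hv, hS⟩ := ih
      obtain ⟨n, hn, hc⟩ := ((Filter.eventually_ge_atTop 1).and
        (B i).eventually_isCompl_ker_pow_range_pow).exists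
      obtain ⟨v₁, h₁, v₂, ⟨u, rfl⟩, rfl⟩ := Submodule.mem_sup.1
        (hc.sup_eq_top ▸ Submodule.mem_top : v ∈ _)
      have h₁' : (B i ^ n) v₁ = 0 := h₁
      have hφ2 : φ ((B i ^ n) u) = 0 := by
        obtain ⟨k, rfl⟩ := Nat.exists_eq_add_of_le' hn
        rw [pow_succ']
        exact hφB _ _
      refine ⟨v₁, by rwa [map_add, hφ2, add_zero] at hv, fun j hj => ?_⟩
      rcases Finset.mem_insert.1 hj with rfl | hj
      · exact ⟨n, h₁'⟩
      obtain ⟨k, hk⟩ := hS j hj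
      refine ⟨k, ?_⟩
      rw [map_add] at hk
      have ha : (B j ^ k) v₁ ∈ LinearMap.ker (B i ^ n) := by
        rw [LinearMap.mem_ker, hcomm, h₁', map_zero]
      have hb : (B j ^ k) v₁ ∈ LinearMap.range (B i ^ n) := by
        rw [eq_neg_of_add_eq_zero_left hk, hcomm, ← map_neg]
        exact LinearMap.mem_range_self _ _
      exact Submodule.disjoint_def.1 hc.disjoint _ ha hb
  have exists_killed : ∀ S : Finset ι,
      ∃ v, v ≠ 0 ∧ (∀ i, ∃ n, (B i ^ n) v = 0) ∧ ∀ i ∈ S, B i v = 0 := by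
    intro S
    induction S using Finset.induction_on with
    | empty =>
      obtain ⟨v, hv, h⟩ := exists_nilpotent univ
      exact ⟨v, fun e => hv (by rw [e, map_zero]), fun i => h i (mem_univ i), by simp⟩
    | insert i S _ ih =>
      obtain ⟨v, hv, hn, hS⟩ := ih
      have hpos : Nat.find (hn i) ≠ 0 := fun e => hv (by simpa [e] using Nat.find_spec (hn i))
      obtain ⟨k, hk⟩ := Nat.exists_eq_succ_of_ne_zero hpos
      refine ⟨(B i ^ k) v, Nat.find_min (hn i) (by omega), fun j => ?_, fun j hj => ?_⟩
      · obtain ⟨n, h⟩ := hn j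
        exact ⟨n, by rw [hcomm, h, map_zero]⟩
      · rcases Finset.mem_insert.1 hj with rfl | hj
        · have := Nat.find_spec (hn j)
          rwa [hk, pow_succ'] at this
        · have := hcomm j i 1 k v
          rwa [pow_one, hS j hj, map_zero] at this
  obtain ⟨v, hv, -, h⟩ := exists_killed univ
  exact ⟨v, hv, fun i => h i (mem_univ i)⟩

end JointEigenvector

section Existence

variable {N : ℕ} {κ : ℚ}

/-- Polynomials of degree `|Λ|` all of whose exponents have at most the height of `Λ`. -/
noncomputable def boundedTerms (Λ : Fin N →₀ ℕ) : Submodule ℚ (MvPolynomial (Fin N) ℚ) :=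
  restrictSupport ℚ {β | β.degree = Λ.degree ∧ expHeight β ≤ expHeight Λ}

lemma cherednik_mem_boundedTerms {Λ : Fin N →₀ ℕ} (i : Fin N) {g : MvPolynomial (Fin N) ℚ}
    (hg : g ∈ boundedTerms Λ) : cherednik κ i g ∈ boundedTerms Λ := by
  rw [g.as_sum, map_sum]
  refine Submodule.sum_mem _ fun α hα => ?_
  obtain ⟨h1, h2⟩ := (mem_restrictSupport_iff ℚ).1 hg hα
  have h3 : monomial α (coeff α g) = coeff α g • monomial α (1 : ℚ) := by
    rw [smul_monomial, smul_eq_mul, mul_one]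
  rw [h3, map_smul]
  refine Submodule.smul_mem _ _ ?_
  rw [← sub_add_cancel (cherednik κ i (monomial α (1 : ℚ)))
    (((α i : ℚ) + κ * lexRank α i) • monomial α (1 : ℚ))]
  refine add_mem (restrictSupport_mono ℚ ?_ (cherednik_monomial_sub_mem i α))
    (Submodule.smul_mem _ _ ((monomial_mem_restrictSupport ℚ).2 (Or.inl ⟨h1, h2⟩)))
  exact fun β hβ => ⟨hβ.1.trans h1, hβ.2.le.trans h2⟩

instance (Λ : Fin N →₀ ℕ) : FiniteDimensional ℚ (boundedTerms Λ) := by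
  have hfin : {β : Fin N →₀ ℕ | β.degree = Λ.degree ∧ expHeight β ≤ expHeight Λ}.Finite :=
    (Finsupp.finite_of_degree_le Λ.degree).subset fun β hβ => hβ.1.le
  have := hfin.to_subtype
  exact Module.Basis.finiteDimensional_of_finite (basisRestrictSupport ℚ _)

/-- A nonzero joint eigenvector of the Cherednik operators with the eigenvalues of `Λ`. -/
theorem exists_joint_eigenvector (κ : ℚ) (Λ : Fin N →₀ ℕ) :
    ∃ f : MvPolynomial (Fin N) ℚ, f ≠ 0 ∧ f.IsHomogeneous Λ.degree ∧
      ∀ i, cherednik κ i f = ((Λ i : ℚ) + κ * lexRank Λ i) • f := by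
  let ξ : Fin N → ℚ := fun i => (Λ i : ℚ) + κ * lexRank Λ i
  let A : Fin N → Module.End ℚ (boundedTerms Λ) := fun i =>
    (cherednik κ i).restrict fun g hg => cherednik_mem_boundedTerms i hg
  let B : Fin N → Module.End ℚ (boundedTerms Λ) := fun i => A i - ξ i • 1
  have hA : ∀ i j, Commute (A i) (A j) := fun i j =>
    LinearMap.ext fun g => Subtype.ext (cherednik_comm i j g)
  have hB : ∀ i j, Commute (B i) (B j) := fun i j => by
    refine LinearMap.ext fun g => ?_
    have h1 : A i (A j g) = A j (A i g) := LinearMap.congr_fun (hA i j).eq g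
    simp only [B, Module.End.mul_apply, LinearMap.sub_apply, LinearMap.smul_apply,
      Module.End.one_apply, map_sub, map_smul, h1]
    module
  let φ : boundedTerms Λ →ₗ[ℚ] ℚ := lcoeff ℚ Λ ∘ₗ (boundedTerms Λ).subtype
  have hφ : φ ≠ 0 := by
    intro h
    have := LinearMap.congr_fun h
      ⟨monomial Λ 1, (monomial_mem_restrictSupport ℚ).2 (Or.inl ⟨rfl, le_rfl⟩)⟩
    simp [φ] at this
  have hφB : ∀ i v, φ (B i v) = 0 := by
    intro i v
    have h1 := coeff_cherednik (κ := κ) i (β := Λ) (g := v)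
      fun α hα => ((mem_restrictSupport_iff ℚ).1 v.2 hα).2
    simp [φ, B, A, ξ, h1]
  obtain ⟨f, hf, h⟩ := exists_common_kernel B hB φ hφ hφB
  refine ⟨f, by simpa using hf, ?_, fun i => ?_⟩
  · intro d hd
    refine (DFunLike.congr_fun Finsupp.degree_eq_weight_one d).symm.trans ?_
    exact ((mem_restrictSupport_iff ℚ).1 f.2 (mem_support_iff.2 hd)).1
  · have := congrArg Subtype.val (h i)
    simpa [B, A, sub_eq_zero] using this

end Existence

section Degree

/-- The multiplicity `t` with `cellContent j = j - (μ + 1) * t`. -/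
def cellWeight (μ s j : ℕ) : ℕ := if cellRow μ s j = 0 then 0 else s + cellRow μ s j

variable {μ s : ℕ}

lemma cellContent_eq_sub (j : ℕ) :
    cellContent μ s j = (j : ℤ) - (μ + 1 : ℕ) * cellWeight μ s j := by
  unfold cellContent cellWeight
  split_ifs <;> simp

lemma cellWeight_mono : Monotone (cellWeight μ s) := by
  intro i j hij
  have := cellRow_mono (μ := μ) (s := s) hij
  unfold cellWeight
  split_ifs <;> omega

lemma sum_cellWeight_range (hμ : 1 ≤ μ) (r : ℕ) {ρ : ℕ} (hρ : ρ ≤ μ) :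
    ∑ j ∈ range (s * μ + s + (r + 1) * μ + ρ), cellWeight μ s j =
      ρ * (s + r + 1) + μ * ∑ i ∈ Icc 1 r, (s + i) := by
  have hrow : ∀ r c, c < μ → cellWeight μ s (s * μ + s + (r + 1) * μ + c) = s + r + 1 := by
    intro r c hc
    rw [cellWeight, cellRow_rowStart_add hμ r.succ_ne_zero hc, if_neg r.succ_ne_zero]
    omega
  have key : ∀ r ρ, ρ ≤ μ → ∑ j ∈ range (s * μ + s + (r + 1) * μ + ρ), cellWeight μ s j =
      ∑ j ∈ range (s * μ + s + (r + 1) * μ), cellWeight μ s j + ρ * (s + r + 1) := by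
    intro r ρ hρ
    rw [sum_range_add, sum_congr rfl fun c hc => hrow r c ((mem_range.1 hc).trans_le hρ)]
    simp
  rw [key r ρ hρ, add_comm]
  congr 1
  induction r with
  | zero =>
    rw [sum_eq_zero]
    · simp
    · intro j hj
      rw [cellWeight, if_pos]
      rw [cellRow_eq_zero_iff]
      simpa using hj
  | succ r ih =>
    rw [show s * μ + s + (r + 1 + 1) * μ = s * μ + s + (r + 1) * μ + μ by ring, key r μ le_rfl, ih,
      sum_Icc_succ_top (by omega)]
    ring

end Degree

section Assembly

variable {μ s l ρ m N : ℕ} {κ : ℚ}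

lemma exists_eq_mul_of_eigenvalue (hm : 1 ≤ m) (hgcd : Nat.gcd m (μ + 1) = 1)
    (hκ : κ = -(m : ℚ) / (μ + 1)) {β : Fin N → ℕ} {w : Fin N → ℤ}
    (h : ∀ p, κ * w p = β p + κ * lexRank β p) :
    ∃ τ : Fin N → ℕ, (∀ p, β p = m * τ p) ∧
      ∀ p, (lexRank τ p : ℤ) = (μ + 1 : ℕ) * τ p + w p := by
  have h1 : ∀ p, ((μ + 1 : ℕ) : ℤ) * β p = m * (lexRank β p - w p) := by
    intro p
    have h2 := h p
    rw [hκ] at h2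
    field_simp at h2
    have h3 : (((μ + 1 : ℕ) : ℤ) * β p : ℚ) = m * ((lexRank β p : ℤ) - w p) := by
      push_cast
      linarith
    exact_mod_cast h3
  have hdvd : ∀ p, m ∣ β p := by
    intro p
    have h2 : (m : ℤ) ∣ ((μ + 1 : ℕ) : ℤ) * β p := ⟨_, h1 p⟩
    exact (Nat.Coprime.dvd_mul_left hgcd).1 (by exact_mod_cast h2)
  choose τ hτ using hdvd
  obtain rfl : β = fun p => m * τ p := funext hτ
  refine ⟨τ, fun _ => rfl, fun p => ?_⟩
  have h2 := h1 p
  rw [lexRank_mul hm] at h2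
  push_cast at h2
  have hm0 : (m : ℤ) ≠ 0 := by positivity
  have h3 := mul_left_cancel₀ hm0 (show (m : ℤ) * ((μ + 1) * τ p) = m * (lexRank τ p - w p) by
    linarith)
  push_cast
  linarith

lemma exists_top_exponent (hm : 1 ≤ m) (hgcd : Nat.gcd m (μ + 1) = 1)
    (hκ : κ = -(m : ℚ) / (μ + 1)) {g : MvPolynomial (Fin N) ℚ} (hg : g ≠ 0) {w : Fin N → ℤ}
    (hw : ∀ p, cherednik κ p g = (κ * w p) • g) :
    ∃ τ : Fin N → ℕ, (∀ p, (lexRank τ p : ℤ) = (μ + 1 : ℕ) * τ p + w p) ∧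
      ∀ p q, p ≤ q → rename (Equiv.swap p q) g = g → τ p ≤ τ q := by
  obtain ⟨β, hβ, hmax⟩ := g.support.exists_max_image expHeight (support_nonempty.2 hg)
  obtain ⟨τ, hτ, hR⟩ := exists_eq_mul_of_eigenvalue hm hgcd hκ
    fun p => eigenvalue_eq_of_max (hw p) hβ hmax
  refine ⟨τ, hR, fun p q hpq hs => ?_⟩
  by_contra! hlt
  have hne : p ≠ q := fun e => by rw [e] at hlt; exact hlt.false
  have hmem : β.mapDomain (Equiv.swap p q) ∈ g.support := by
    rw [mem_support_iff, ← hs, coeff_rename_mapDomain _ (Equiv.injective _)]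
    exact mem_support_iff.1 hβ
  have h1 := hmax _ hmem
  have h2 := expHeight_mapDomain_swap_lt (α := β.mapDomain (Equiv.swap p q))
    (lt_of_le_of_ne hpq hne) (by
      rw [mapDomain_swap_apply, mapDomain_swap_apply, Equiv.swap_apply_left,
        Equiv.swap_apply_right, hτ, hτ]
      exact Nat.mul_lt_mul_of_pos_left hlt hm)
  rw [← Finsupp.mapDomain_comp, ← Equiv.coe_trans, Equiv.swap_swap, Equiv.coe_refl,
    Finsupp.mapDomain_id] at h2
  omega

lemma rename_swap_self (p q : Fin N) (g : MvPolynomial (Fin N) ℚ) :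
    rename (Equiv.swap p q) (rename (Equiv.swap p q) g) = g := by
  rw [rename_rename, ← Equiv.coe_trans, Equiv.swap_swap]
  simp

lemma cellRow_le (hμ : 1 ≤ μ) (hρμ : ρ ≤ μ) (hN : N = (s + l + 1) * μ + s + ρ) {j : ℕ}
    (hj : j < N) : cellRow μ s j ≤ l + 1 := by
  by_contra! h
  have := (rowStart_le_iff (s := s) (r := l + 2) (j := j) hμ).2 h
  simp only [rowStart, Nat.add_eq_zero_iff, OfNat.ofNat_ne_zero, and_false, if_false] at this
  nlinarith

lemma cellContent_rowStart_add (hμ : 1 ≤ μ) {r d : ℕ}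
    (h : rowStart μ s r + d < rowStart μ s (r + 1)) :
    cellContent μ s (rowStart μ s r + d) = -(r : ℤ) + d := by
  induction d with
  | zero => simpa using cellContent_rowStart (s := s) hμ r
  | succ d ih =>
    have h1 := (rowStart_le_iff (s := s) (r := r) (j := rowStart μ s r + d) hμ).1 (by omega)
    have h2 := (rowStart_le_iff (s := s) (r := r + 1) (j := rowStart μ s r + (d + 1)) hμ).not.1
      (by omega)
    rcases cell_succ (s := s) hμ (rowStart μ s r + d) with ⟨-, h3⟩ | ⟨h3, -⟩
    · rw [← add_assoc, h3, ih (by omega)]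
      push_cast; ring
    · rw [add_assoc] at h3
      omega

/-- A joint eigenvector with the eigenvalues of the contents is symmetric within rows. -/
lemma rename_swap_eq_of_row_succ (hμ : 1 ≤ μ) (hρ : 1 ≤ ρ) (hρμ : ρ ≤ μ)
    (hN : N = (s + l + 1) * μ + s + ρ) (hm : 1 ≤ m) (hgcd : Nat.gcd m (μ + 1) = 1)
    (hκ : κ = -(m : ℚ) / (μ + 1)) {f : MvPolynomial (Fin N) ℚ}
    (hf : ∀ p : Fin N, cherednik κ p f = (κ * cellContent μ s p) • f) {P Q : Fin N}
    (hPQ : (P : ℕ) + 1 = Q) (hrow : cellRow μ s P = cellRow μ s Q) :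
    rename (Equiv.swap P Q) f = f := by
  by_contra hne
  have hcQ : (cellContent μ s Q : ℚ) = cellContent μ s P + 1 := by
    rcases cell_succ (s := s) hμ P with ⟨-, h⟩ | ⟨h, -⟩
    · rw [← hPQ, h]; push_cast; rfl
    · rw [hPQ] at h; omega
  have hltPQ : P < Q := by rw [Fin.lt_def]; omega
  have hw : ∀ p, cherednik κ p (rename (Equiv.swap P Q) f - f) =
      (κ * (cellContent μ s (Equiv.swap P Q p) : ℤ)) • (rename (Equiv.swap P Q) f - f) := by
    intro p
    rcases eq_or_ne p P with rfl | hp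
    · have h := cherednik_swap_succ (κ := κ) hPQ (rename (Equiv.swap p Q) f)
      rw [rename_swap_self, hf] at h
      have h2 : cherednik κ p (rename (Equiv.swap p Q) f) =
          rename (Equiv.swap p Q) ((κ * cellContent μ s Q) • f -
            κ • rename (Equiv.swap p Q) f) := by
        rw [h, add_sub_cancel_right, rename_swap_self]
      rw [map_sub, map_smul, map_smul, rename_swap_self] at h2
      rw [map_sub, h2, hf, Equiv.swap_apply_left, hcQ]
      module
    rcases eq_or_ne p Q with rfl | hq
    · rw [map_sub, cherednik_swap_succ hPQ, hf, hf, map_smul, Equiv.swap_apply_right, hcQ]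
      module
    · have hiff : P < p ↔ Q < p := by
        rw [Fin.ext_iff.ne] at hq hp
        rw [Fin.lt_def, Fin.lt_def]
        omega
      rw [map_sub, ← rename_swap_cherednik hp hq hiff, hf, map_smul,
        Equiv.swap_apply_of_ne_of_ne hp hq, smul_sub]
  obtain ⟨τ, hR, -⟩ := exists_top_exponent hm hgcd hκ (sub_ne_zero.2 hne) hw
  exact false_of_swap_row hμ hρ hρμ hN hPQ hrow (cellRow_le hμ hρμ hN P.2) (fun _ => rfl) hR

lemma rename_swap_eq_of_row (hμ : 1 ≤ μ) (hρ : 1 ≤ ρ) (hρμ : ρ ≤ μ)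
    (hN : N = (s + l + 1) * μ + s + ρ) (hm : 1 ≤ m) (hgcd : Nat.gcd m (μ + 1) = 1)
    (hκ : κ = -(m : ℚ) / (μ + 1)) {f : MvPolynomial (Fin N) ℚ}
    (hf : ∀ p : Fin N, cherednik κ p f = (κ * cellContent μ s p) • f) {P Q : Fin N}
    (hrow : cellRow μ s P = cellRow μ s Q) : rename (Equiv.swap P Q) f = f := by
  wlog hle : P ≤ Q generalizing P Q
  · rw [Equiv.swap_comm]
    exact this hrow.symm (le_of_not_ge hle)
  obtain ⟨d, hd⟩ := Nat.exists_eq_add_of_le (show (P : ℕ) ≤ Q from hle)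
  clear hle
  induction d generalizing Q with
  | zero =>
    obtain rfl : Q = P := Fin.ext hd
    simp
  | succ d ih =>
    let R : Fin N := ⟨P + d, by omega⟩
    have hRQ : (R : ℕ) + 1 = Q := by simp only [R]; omega
    have h1 : cellRow μ s P ≤ cellRow μ s R := cellRow_mono (by simp [R])
    have h2 : cellRow μ s R ≤ cellRow μ s Q := cellRow_mono (by omega)
    have hPR := ih (Q := R) (by omega) rfl
    have hadj := rename_swap_eq_of_row_succ hμ hρ hρμ hN hm hgcd hκ hf hRQ (by omega)
    rcases eq_or_ne P R with hPR' | hne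
    · rwa [hPR']
    have h3 := rename_comp_swap (Equiv.swap R Q) P R f
    have hPQ : P ≠ Q := fun e => by rw [e] at hd; omega
    rw [hPR, hadj, Equiv.swap_apply_left, Equiv.swap_apply_of_ne_of_ne hne hPQ] at h3
    exact h3.symm

/-- If `f` is symmetric on `[b, k)`, its symmetrization over `[b, k]` is symmetric there. -/
lemma rename_swap_sum_eq {b k : Fin N} {f : MvPolynomial (Fin N) ℚ}
    (hf : ∀ i j, i ∈ Ico b k → j ∈ Ico b k → rename (Equiv.swap i j) f = f) {p q : Fin N}
    (hp : p ∈ Icc b k) (hq : q ∈ Icc b k) :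
    rename (Equiv.swap p q) (∑ j ∈ Icc b k, rename (Equiv.swap k j) f) =
      ∑ j ∈ Icc b k, rename (Equiv.swap k j) f := by
  wlog hpq : p < q generalizing p q
  · rcases eq_or_lt_of_not_gt hpq with rfl | h
    · simp
    · rw [Equiv.swap_comm]; exact this hq hp h
  have hpk : p ∈ Ico b k := by
    rw [mem_Icc] at hp hq
    exact mem_Ico.2 ⟨hp.1, hpq.trans_le hq.2⟩
  rw [map_sum]
  refine sum_bij (fun j _ => Equiv.swap p q j) ?_ (fun _ _ _ _ h => (Equiv.swap p q).injective h)
    ?_ ?_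
  · intro j hj
    rw [Equiv.swap_apply_def]
    split_ifs <;> assumption
  · intro j hj
    refine ⟨Equiv.swap p q j, ?_, by simp⟩
    rw [Equiv.swap_apply_def]
    split_ifs <;> assumption
  · intro j hj
    rcases eq_or_ne q k with rfl | hqk
    · rcases eq_or_ne j p with rfl | hjp
      · rw [Equiv.swap_apply_left, Equiv.swap_comm q j, rename_swap_self]; simp
      rcases eq_or_ne j q with rfl | hjq
      · rw [Equiv.swap_apply_right]
        simp [Equiv.swap_comm]
      · have hj' : j ∈ Ico b q := mem_Ico.2 ⟨(mem_Icc.1 hj).1, lt_of_le_of_ne (mem_Icc.1 hj).2 hjq⟩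
        have h := rename_comp_swap (Equiv.swap q j) p j f
        rw [hf p j hpk hj', Equiv.swap_apply_right, Equiv.swap_apply_of_ne_of_ne hpq.ne hjp.symm]
          at h
        rw [Equiv.swap_apply_of_ne_of_ne hjp hjq, ← h]
    · have hqk' : q ∈ Ico b k := mem_Ico.2 ⟨(mem_Icc.1 hq).1, lt_of_le_of_ne (mem_Icc.1 hq).2 hqk⟩
      rw [rename_comp_swap, hf p q hpk hqk', Equiv.swap_apply_of_ne_of_ne (mem_Ico.1 hpk).2.ne'
        hqk.symm]

lemma cherednik_rename_swap {b k : Fin N} (hbk : b < k) (g : MvPolynomial (Fin N) ℚ) :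
    cherednik κ b (rename (Equiv.swap k b) g) =
      rename (Equiv.swap k b) (cherednik κ k g - κ • ∑ i ∈ Ico b k, rename (Equiv.swap k i) g) := by
  have hsplit : ∑ i ∈ Iio k, rename (Equiv.swap k i) g =
      ∑ i ∈ Iio b, rename (Equiv.swap k i) g + ∑ i ∈ Ico b k, rename (Equiv.swap k i) g := by
    rw [← sum_union]
    · congr 1
      ext i
      simp only [mem_union, mem_Iio, mem_Ico]
      exact ⟨fun h => (lt_or_ge i b).imp_right fun h' => ⟨h', h⟩,
        fun h => h.elim (fun h => h.trans hbk) fun h => h.2⟩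
    · rw [disjoint_left]
      intro i hi hi'
      exact ((mem_Ico.1 hi').1.trans_lt (mem_Iio.1 hi)).false
  rw [cherednik_apply, cherednik_apply, hsplit, smul_add, ← add_assoc, add_sub_cancel_right,
    map_add, map_mul, rename_X, rename_dunkl, Equiv.swap_apply_left, map_smul, map_sum]
  congr 2
  refine sum_congr rfl fun i hi => ?_
  have hi := mem_Iio.1 hi
  rw [rename_comp_swap (Equiv.swap k b), Equiv.swap_apply_left,
    Equiv.swap_apply_of_ne_of_ne (hi.trans hbk).ne hi.ne]

/-- The symmetrization of a joint eigenvector over a row and the first cell of the next row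
vanishes. -/
lemma sum_rename_swap_eq_zero (hμ : 1 ≤ μ) (hρ : 1 ≤ ρ) (hρμ : ρ ≤ μ)
    (hN : N = (s + l + 1) * μ + s + ρ) (hm : 1 ≤ m) (hgcd : Nat.gcd m (μ + 1) = 1)
    (hκ : κ = -(m : ℚ) / (μ + 1)) {f : MvPolynomial (Fin N) ℚ}
    (hf : ∀ p : Fin N, cherednik κ p f = (κ * cellContent μ s p) • f) {r : ℕ} (hr : r ≤ l)
    {b k : Fin N} (hb : (b : ℕ) = rowStart μ s r) (hk : (k : ℕ) = rowStart μ s (r + 1)) :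
    ∑ j ∈ Icc b k, rename (Equiv.swap k j) f = 0 := by
  have hbk : b < k := by
    rw [Fin.lt_def]
    by_contra h
    have := (rowStart_le_iff (s := s) (r := r + 1) (j := b) hμ).1 (by omega)
    rw [hb, cellRow_rowStart hμ] at this
    omega
  have hrowIco : ∀ i ∈ Ico b k, cellRow μ s i = r := by
    intro i hi
    rw [mem_Ico, Fin.le_def, Fin.lt_def] at hi
    have h1 := (rowStart_le_iff (s := s) (r := r) (j := i) hμ).1 (by omega)
    have h2 := (rowStart_le_iff (s := s) (r := r + 1) (j := i) hμ).not.1 (by omega)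
    omega
  have hsymf : ∀ i j, i ∈ Ico b k → j ∈ Ico b k → rename (Equiv.swap i j) f = f :=
    fun i j hi hj => rename_swap_eq_of_row hμ hρ hρμ hN hm hgcd hκ hf
      ((hrowIco i hi).trans (hrowIco j hj).symm)
  have hcb : cellContent μ s b = -(r : ℤ) := by rw [hb, cellContent_rowStart hμ]
  have hck : cellContent μ s k = -((r : ℤ) + 1) := by
    rw [hk, cellContent_rowStart hμ]; push_cast; ring
  by_contra hne
  set E := ∑ j ∈ Icc b k, rename (Equiv.swap k j) f with hE
  have hsymE : ∀ p q, p ∈ Icc b k → q ∈ Icc b k → rename (Equiv.swap p q) E = E :=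
    fun p q hp hq => rename_swap_sum_eq hsymf hp hq
  have hEsplit : E = f + (rename (Equiv.swap k b) f + ∑ j ∈ Ioo b k, rename (Equiv.swap k j) f) := by
    rw [hE, ← Ico_insert_right hbk.le, sum_insert (by simp), ← Ioo_insert_left hbk,
      sum_insert (by simp)]
    simp
  have hEout : ∀ q, q < b ∨ k < q → cherednik κ q E = (κ * cellContent μ s q) • E := by
    intro q hq
    rw [hE, map_sum, smul_sum]
    refine sum_congr rfl fun j hj => ?_
    rw [mem_Icc] at hj
    have hj1 : q ≠ j := by
      rintro rfl
      exact hq.elim (fun h => h.not_ge hj.1) fun h => h.not_ge hj.2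
    have hk1 : q ≠ k := by
      rintro rfl
      exact hq.elim (fun h => h.not_ge hbk.le) fun h => h.false
    have hiff : k < q ↔ j < q := by
      rcases hq with h | h
      · exact ⟨fun h' => absurd (h'.trans h) hbk.not_gt, fun h' => absurd (h'.trans h) hj.1.not_gt⟩
      · exact ⟨fun _ => hj.2.trans_lt h, fun _ => h⟩
    rw [← rename_swap_cherednik hk1 hj1 hiff, hf, map_smul]
  have hEb : cherednik κ b E = (κ * (-((r : ℚ) + 1))) • E := by
    have h1 : ∀ j ∈ Ioo b k, cherednik κ b (rename (Equiv.swap k j) f) =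
        (κ * -(r : ℚ)) • rename (Equiv.swap k j) f := by
      intro j hj
      rw [mem_Ioo] at hj
      rw [← rename_swap_cherednik hbk.ne hj.1.ne
        ⟨fun h => absurd h hbk.not_gt, fun h => absurd h hj.1.not_gt⟩, hf, map_smul, hcb]
      push_cast; rfl
    have h2 : ∀ j ∈ Ioo b k, rename (Equiv.swap k b) (rename (Equiv.swap k j) f) =
        rename (Equiv.swap k j) f := by
      intro j hj
      rw [mem_Ioo] at hj
      have h := rename_comp_swap (Equiv.swap k j) b j f
      rw [hsymf b j (mem_Ico.2 ⟨le_rfl, hbk⟩) (mem_Ico.2 ⟨hj.1.le, hj.2⟩), Equiv.swap_apply_right,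
        Equiv.swap_apply_of_ne_of_ne hbk.ne hj.1.ne, Equiv.swap_comm b k] at h
      exact h.symm
    rw [hEsplit, map_add, map_add, map_sum, sum_congr rfl h1, ← smul_sum, cherednik_rename_swap hbk,
      hf, hf, map_sub, map_smul, map_smul, map_sum, ← Ioo_insert_left hbk, sum_insert (by simp),
      rename_swap_self, sum_congr rfl h2, hcb, hck]
    push_cast
    module
  have hEmid : ∀ d : ℕ, ∀ q : Fin N, (q : ℕ) = b + d → q ≤ k →
      cherednik κ q E = (κ * (-((r : ℚ) + 1) + d)) • E := by
    intro d
    induction d with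
    | zero =>
      intro q hq _
      obtain rfl : q = b := Fin.ext hq
      simpa using hEb
    | succ d ih =>
      intro q hq hqk
      rw [Fin.le_def] at hqk
      let p : Fin N := ⟨b + d, by omega⟩
      have hpq : (p : ℕ) + 1 = q := by simp only [p]; omega
      have hpk : p ≤ k := by rw [Fin.le_def]; omega
      have hbp : b ≤ p := by rw [Fin.le_def]; simp [p]
      have h := cherednik_swap_succ (κ := κ) hpq E
      rw [hsymE p q (mem_Icc.2 ⟨hbp, hpk⟩) (mem_Icc.2 ⟨by rw [Fin.le_def]; omega, hqk⟩),
        ih p rfl hpk, map_smul,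
        hsymE p q (mem_Icc.2 ⟨hbp, hpk⟩) (mem_Icc.2 ⟨by rw [Fin.le_def]; omega, hqk⟩)] at h
      rw [h]
      push_cast
      module
  have : NeZero N := ⟨by have := b.2; omega⟩
  let π : Equiv.Perm (Fin N) := (Fin.cycleIcc b k).symm
  have hπlt : ∀ p, p < b → π p = p := fun p hp => by
    rw [Equiv.symm_apply_eq, Fin.cycleIcc_of_lt hp]
  have hπgt : ∀ p, k < p → π p = p := fun p hp => by
    rw [Equiv.symm_apply_eq, Fin.cycleIcc_of_gt hp]
  have hπb : π b = k := by
    rw [Equiv.symm_apply_eq, Fin.cycleIcc_of_last hbk.le]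
  have hπmid : ∀ p q : Fin N, b ≤ p → (p : ℕ) + 1 = q → q ≤ k → π q = p := by
    intro p q hbp hpq hqk
    rw [Fin.le_def] at hqk
    rw [Equiv.symm_apply_eq, Fin.cycleIcc_of_ge_of_lt hbp (by rw [Fin.lt_def]; omega)]
    apply Fin.ext
    rw [Fin.val_add_one_of_lt' (by omega), hpq]
  let w : Fin N → ℤ := fun p => cellContent μ s (π p)
  have hw : ∀ p, cherednik κ p E = (κ * w p) • E := by
    intro p
    by_cases hp : p < b ∨ k < p
    · rw [hEout p hp]
      simp only [w]
      rw [hp.elim (hπlt p) (hπgt p)]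
    · push Not at hp
      obtain ⟨d, hd⟩ := Nat.exists_eq_add_of_le (show (b : ℕ) ≤ p from hp.1)
      rw [hEmid d p hd hp.2]
      congr 2
      rcases Nat.eq_zero_or_pos d with rfl | hd0
      · obtain rfl : p = b := Fin.ext hd
        simp only [w]
        rw [hπb, hck]
        push_cast; ring
      · have hpk : (p : ℕ) ≤ k := hp.2
        have h1 := hπmid ⟨b + (d - 1), by omega⟩ p (by rw [Fin.le_def]; simp)
          (by simp only; omega) hp.2
        simp only [w]
        rw [h1]
        simp only
        rw [hb, cellContent_rowStart_add hμ (by omega)]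
        push_cast [Nat.cast_sub (show 1 ≤ d from hd0)]
        ring
  obtain ⟨τ, hR, hτ⟩ := exists_top_exponent hm hgcd hκ hne hw
  refine false_of_cycle_row (w := w) (π := π) hμ hρ hρμ hN hr hb hk (fun _ => rfl)
    (fun p hp => by simp only [w]; rw [hπlt p hp]) (fun p hp => by simp only [w]; rw [hπgt p hp])
    (by simp only [w]; rw [hπb, hck])
    (fun p q h1 h2 h3 => by simp only [w]; rw [hπmid p q h1 h2 h3])
    (fun p q h1 h2 h3 => hτ p q h2 (hsymE p q (mem_Icc.2 ⟨h1, h2.trans h3⟩)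
      (mem_Icc.2 ⟨h1.trans h2, h3⟩))) hR

/-- A joint eigenvector with the eigenvalues of the contents is singular. -/
theorem dunkl_eq_zero (hμ : 1 ≤ μ) (hρ : 1 ≤ ρ) (hρμ : ρ ≤ μ)
    (hN : N = (s + l + 1) * μ + s + ρ) (hm : 1 ≤ m) (hgcd : Nat.gcd m (μ + 1) = 1)
    (hκ : κ = -(m : ℚ) / (μ + 1)) {f : MvPolynomial (Fin N) ℚ}
    (hf : ∀ p : Fin N, cherednik κ p f = (κ * cellContent μ s p) • f) (p : Fin N) :
    dunkl κ p f = 0 := by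
  obtain ⟨p, hp⟩ := p
  induction p using Nat.strong_induction_on with
  | _ p ih =>
    rcases p with _ | p
    · have h1 := hf ⟨0, hp⟩
      have h2 : cellContent μ s 0 = 0 := by
        simpa [rowStart] using cellContent_rowStart (s := s) hμ 0
      have h3 : (Iio (⟨0, hp⟩ : Fin N)) = ∅ := by
        ext x; rw [mem_Iio, Fin.lt_def]; simp
      rw [cherednik_apply, h3] at h1
      simpa [h2, X_ne_zero] using h1
    · let P : Fin N := ⟨p, by omega⟩
      rcases cell_succ (s := s) hμ p with ⟨h1, -⟩ | ⟨h1, h2, -⟩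
      · have hs := rename_swap_eq_of_row hμ hρ hρμ hN hm hgcd hκ hf (P := P) (Q := ⟨p + 1, hp⟩)
          h1.symm
        have h3 := rename_dunkl (κ := κ) (Equiv.swap P ⟨p + 1, hp⟩) P f
        rw [hs, Equiv.swap_apply_left, ih p (by omega), map_zero] at h3
        exact h3.symm
      · set r := cellRow μ s p with hr
        have hrl : r ≤ l := by
          have := cellRow_le hμ hρμ hN hp
          omega
        have hbp : rowStart μ s r ≤ p := (rowStart_le_iff hμ).2 le_rfl
        let b : Fin N := ⟨rowStart μ s r, by omega⟩
        have hE := sum_rename_swap_eq_zero hμ hρ hρμ hN hm hgcd hκ hf hrl (b := b)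
          (k := ⟨p + 1, hp⟩) rfl h2
        have hbk : b ≤ (⟨p + 1, hp⟩ : Fin N) := by rw [Fin.le_def]; simp only [b]; omega
        rw [← Ico_insert_right hbk, sum_insert (by simp), Equiv.swap_self, Equiv.coe_refl,
          rename_id_apply] at hE
        rw [eq_neg_of_add_eq_zero_left hE, map_neg, map_sum, sum_eq_zero, neg_zero]
        intro j hj
        have hj : j < (⟨p + 1, hp⟩ : Fin N) := (mem_Ico.1 hj).2
        have h3 := rename_dunkl (κ := κ) (Equiv.swap ⟨p + 1, hp⟩ j) j f
        rw [Equiv.swap_apply_right, ih j hj j.2, map_zero] at h3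
        exact h3.symm

end Assembly

/-- for `N = (s+l+1)μ+s+ρ` and `κ₀ = -m/(μ+1)` with
`gcd(m,μ+1) = 1`, there exists a nonzero polynomial `f` in `N` variables,
homogeneous of degree `|Λ(μ,s,l,ρ,m)| = m(ρ(s+l+1) + μ Σ_{i=1}^{l}(s+i))`,
annihilated by every Dunkl operator `D_i = ∂/∂x_i + κ₀ Σ_{j≠i} Δ_{ij}`; in
particular `κ₀` is a singular value for `S_N`. -/
theorem exists_singular_polynomial (μ s l ρ m : ℕ)
    (hμ : 1 ≤ μ) (hl : 1 ≤ l) (hρ1 : 1 ≤ ρ) (hρμ : ρ ≤ μ) (hm : 1 ≤ m)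
    (hgcd : Nat.gcd m (μ + 1) = 1)
    (N : ℕ) (hN : N = (s + l + 1) * μ + s + ρ)
    (κ₀ : ℚ) (hκ : κ₀ = -(m : ℚ) / (μ + 1))
    (Δ : Fin N → Fin N → MvPolynomial (Fin N) ℚ → MvPolynomial (Fin N) ℚ)
    (hΔ : ∀ i j : Fin N, i ≠ j → ∀ g : MvPolynomial (Fin N) ℚ,
      (X i - X j) * Δ i j g = g - rename (Equiv.swap i j) g) :
    ∃ f : MvPolynomial (Fin N) ℚ, f ≠ 0 ∧
      f.IsHomogeneous (m * (ρ * (s + l + 1) + μ * ∑ i ∈ Finset.Icc 1 l, (s + i))) ∧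
      ∀ i : Fin N, pderiv i f + κ₀ • ∑ j ∈ Finset.univ.erase i, Δ i j f = 0 := by
  have hΔeq : ∀ i, ∀ g, pderiv i g + κ₀ • ∑ j ∈ Finset.univ.erase i, Δ i j g = dunkl κ₀ i g := by
    intro i g
    rw [dunkl_apply, Finset.sum_congr rfl fun j hj =>
      eq_dividedDiff (ne_of_mem_erase hj).symm (hΔ i j (ne_of_mem_erase hj).symm g)]
  let Λ : Fin N →₀ ℕ := Finsupp.equivFunOnFinite.symm fun p => m * cellWeight μ s p
  have hΛ : ∀ p, Λ p = m * cellWeight μ s p := fun _ => rfl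
  have hdeg : Λ.degree = m * (ρ * (s + l + 1) + μ * ∑ i ∈ Finset.Icc 1 l, (s + i)) := by
    rw [Finsupp.degree_eq_sum]
    simp only [hΛ]
    rw [← Finset.mul_sum, Fin.sum_univ_eq_sum_range (cellWeight μ s),
      ← sum_cellWeight_range hμ l hρμ, hN]
    congr 3
    ring
  have hmono : Monotone Λ := fun p q hpq => by
    rw [hΛ, hΛ]
    exact Nat.mul_le_mul_left _ (cellWeight_mono hpq)
  obtain ⟨f, hf0, hfhom, hf⟩ := exists_joint_eigenvector κ₀ Λ
  refine ⟨f, hf0, hdeg ▸ hfhom, fun i => ?_⟩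
  rw [hΔeq]
  refine dunkl_eq_zero hμ hρ1 hρμ hN hm hgcd hκ (fun p => ?_) i
  rw [hf p, lexRank_eq_self_of_monotone hmono, hΛ, cellContent_eq_sub, hκ]
  congr 1
  push_cast
  field_simp
  ring
end

section
/- Let μ, l ≥ 1, s ≥ 0, 1 ≤ ρ ≤ μ, and let τ = (s(μ+1)+μ, μ, …, μ, ρ) (with l copies of μ) and N = |τ| = (s+l+1)μ+s+ρ. Then C(N,2) − Σ_{i≥1} Σ_{j=1}^{τ_i} (j−i) = (μ+1)·(ρ(s+l+1) + μl(l+2s+1)/2). Consequently, for any m ≥ 1 with gcd(m,μ+1)=1, this quantity equals ((μ+1)/m)·|Λ(μ,s,l,ρ,m)|. -/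
open Finset

/-- The partition `Λ(μ,s,l,ρ,m)` as a 1-based function, padded with zeros. -/
def Lam1 (μ s l ρ m : ℕ) : ℕ → ℕ := fun i =>
  if i = 0 then 0
  else if i ≤ ρ then m * (s + l + 1)
  else if i ≤ ρ + l * μ then m * (s + l - (i - ρ - 1) / μ)
  else 0

/-- The partition `τ = (s(μ+1)+μ, μ^l, ρ)` as a 1-based function, padded with zeros. -/
def tauF (μ s l ρ : ℕ) : ℕ → ℕ := fun i =>
  if i = 0 then 0
  else if i = 1 then s * (μ + 1) + μ
  else if i ≤ l + 1 then μ
  else if i = l + 2 then ρ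
  else 0

theorem sum_Icc_one_eq_sum_range {M : Type*} [AddCommMonoid M] (f : ℕ → M) (n : ℕ) :
    ∑ i ∈ Finset.Icc 1 n, f i = ∑ i ∈ Finset.range n, f (i + 1) := by
  induction n with
  | zero => simp
  | succ n ih => rw [Finset.sum_Icc_succ_top (by omega), ih, Finset.sum_range_succ]

theorem sum_contents_row (k : ℕ) (i : ℚ) :
    ∑ j ∈ Finset.Icc 1 k, ((j : ℚ) - i) = (k : ℚ) * (k + 1) / 2 - i * k := by
  induction k with
  | zero => simp
  | succ n ih =>
    rw [Finset.sum_Icc_succ_top (by omega), ih]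
    push_cast
    ring

theorem sum_range_mul_div {M : Type*} [AddCommMonoid M] (f : ℕ → M) (l : ℕ) {μ : ℕ}
    (hμ : 0 < μ) :
    ∑ k ∈ Finset.range (l * μ), f (k / μ) = μ • ∑ q ∈ Finset.range l, f q := by
  induction l with
  | zero => simp
  | succ l ih =>
    rw [Nat.succ_mul, Finset.sum_range_add, ih, Finset.sum_range_succ, nsmul_add]
    congr 1
    rw [Finset.sum_congr rfl (g := fun _ => f l), Finset.sum_const, Finset.card_range]
    intro x hx
    rw [add_comm, Nat.add_mul_div_right _ _ hμ, Nat.div_eq_of_lt (Finset.mem_range.1 hx),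
      zero_add]

theorem sum_contents_middle_rows (l : ℕ) (c : ℚ) :
    ∑ i ∈ Finset.range l, (c * (c + 1) / 2 - ((1 + i + 1 : ℕ) : ℚ) * c)
      = l * (c * (c + 1) / 2) - c * (l * (l + 3) / 2) := by
  induction l with
  | zero => simp
  | succ l ih =>
    rw [Finset.sum_range_succ, ih]
    push_cast
    ring

theorem sum_contents_tauF (μ s l ρ N : ℕ) (hN : l + 2 ≤ N) :
    ∑ i ∈ Finset.Icc 1 N, ∑ j ∈ Finset.Icc 1 (tauF μ s l ρ i), ((j : ℚ) - (i : ℚ))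
      = ((s : ℚ) * (μ + 1) + μ) * (s * (μ + 1) + μ - 1) / 2
        + (l * ((μ : ℚ) * (μ + 1) / 2) - μ * (l * (l + 3) / 2))
        + ((ρ : ℚ) * (ρ + 1) / 2 - (l + 2) * ρ) := by
  obtain ⟨r, rfl⟩ : ∃ r, N = 1 + l + 1 + r := ⟨N - (l + 2), by omega⟩
  simp only [sum_contents_row]
  rw [sum_Icc_one_eq_sum_range, Finset.sum_range_add, Finset.sum_range_succ,
    Finset.sum_range_add, Finset.sum_range_one]
  have hfirst : tauF μ s l ρ (0 + 1) = s * (μ + 1) + μ := by simp [tauF]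
  have hmid : ∀ i ∈ Finset.range l, tauF μ s l ρ (1 + i + 1) = μ := by
    intro i hi
    have := Finset.mem_range.1 hi
    simp only [tauF]
    rw [if_neg (by omega), if_neg (by omega), if_pos (by omega)]
  have hlast : tauF μ s l ρ (1 + l + 1) = ρ := by
    simp only [tauF]
    rw [if_neg (by omega), if_neg (by omega), if_neg (by omega), if_pos (by omega)]
  have hzero : ∀ i ∈ Finset.range r, tauF μ s l ρ (1 + l + 1 + i + 1) = 0 := by
    intro i _
    simp only [tauF]
    rw [if_neg (by omega), if_neg (by omega), if_neg (by omega), if_neg (by omega)]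
  rw [Finset.sum_congr rfl fun i hi => by rw [hmid i hi], sum_contents_middle_rows,
    Finset.sum_eq_zero (s := Finset.range r) fun i hi => by rw [hzero i hi]; simp,
    hfirst, hlast]
  push_cast
  ring

theorem sum_range_add_sub (s l : ℕ) :
    ((∑ q ∈ Finset.range l, (s + l - q) : ℕ) : ℚ) = (l : ℚ) * (l + 2 * s + 1) / 2 := by
  induction l with
  | zero => simp
  | succ l ih =>
    rw [Finset.sum_range_succ']
    simp only [← add_assoc, Nat.add_sub_add_right]
    rw [Nat.cast_add, ih]
    push_cast
    ring

theorem sum_Lam1 (μ s l ρ m : ℕ) (hμ : 1 ≤ μ) :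
    ((∑ i ∈ Finset.Icc 1 (ρ + l * μ), Lam1 μ s l ρ m i : ℕ) : ℚ)
      = m * ((ρ : ℚ) * (s + l + 1) + (μ : ℚ) * l * (l + 2 * s + 1) / 2) := by
  have hhead : ∀ i ∈ Finset.range ρ, Lam1 μ s l ρ m (i + 1) = m * (s + l + 1) := by
    intro i hi
    have := Finset.mem_range.1 hi
    simp only [Lam1]
    rw [if_neg (by omega), if_pos (by omega)]
  have htail : ∀ k ∈ Finset.range (l * μ),
      Lam1 μ s l ρ m (ρ + k + 1) = m * (s + l - k / μ) := by
    intro k hk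
    have := Finset.mem_range.1 hk
    simp only [Lam1]
    rw [if_neg (by omega), if_neg (by omega), if_pos (by omega),
      show ρ + k + 1 - ρ - 1 = k by omega]
  rw [sum_Icc_one_eq_sum_range, Finset.sum_range_add, Finset.sum_congr rfl hhead,
    Finset.sum_congr rfl htail, sum_range_mul_div (fun q => m * (s + l - q)) l hμ,
    Finset.sum_const, Finset.card_range, ← Finset.mul_sum, smul_eq_mul, smul_eq_mul,
    Nat.cast_add, Nat.cast_mul μ, Nat.cast_mul m, sum_range_add_sub]
  push_cast
  ring

/-- for `τ = (s(μ+1)+μ, μ^l, ρ)` and `N = |τ| = (s+l+1)μ+s+ρ`,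
`C(N,2) - Σ_{(i,j)∈τ}(j-i) = (μ+1)(ρ(s+l+1) + μl(l+2s+1)/2)`, and for every `m ≥ 1`
with `gcd(m,μ+1) = 1` this equals `((μ+1)/m)·|Λ(μ,s,l,ρ,m)|`. -/
theorem tau_omega_eigenvalue (μ s l ρ : ℕ)
    (hμ : 1 ≤ μ) (hl : 1 ≤ l) (hρ1 : 1 ≤ ρ) (hρμ : ρ ≤ μ)
    (N : ℕ) (hN : N = (s + l + 1) * μ + s + ρ) :
    ((N.choose 2 : ℚ) -
        ∑ i ∈ Finset.Icc 1 N, ∑ j ∈ Finset.Icc 1 (tauF μ s l ρ i), ((j : ℚ) - (i : ℚ)))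
      = ((μ : ℚ) + 1) * ((ρ : ℚ) * (s + l + 1) + (μ : ℚ) * l * (l + 2 * s + 1) / 2) ∧
    ∀ m : ℕ, 1 ≤ m → Nat.gcd m (μ + 1) = 1 →
      ((N.choose 2 : ℚ) -
          ∑ i ∈ Finset.Icc 1 N, ∑ j ∈ Finset.Icc 1 (tauF μ s l ρ i), ((j : ℚ) - (i : ℚ)))
        = (((μ : ℚ) + 1) / (m : ℚ)) * ((∑ i ∈ Finset.Icc 1 (ρ + l * μ), Lam1 μ s l ρ m i : ℕ) : ℚ) := by
  have hNl : l + 2 ≤ N := by nlinarith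
  have key : ((N.choose 2 : ℚ) -
        ∑ i ∈ Finset.Icc 1 N, ∑ j ∈ Finset.Icc 1 (tauF μ s l ρ i), ((j : ℚ) - (i : ℚ)))
      = ((μ : ℚ) + 1) * ((ρ : ℚ) * (s + l + 1) + (μ : ℚ) * l * (l + 2 * s + 1) / 2) := by
    rw [sum_contents_tauF μ s l ρ N hNl, Nat.cast_choose_two, hN]
    push_cast
    ring
  refine ⟨key, fun m hm _ => ?_⟩
  have hm0 : (m : ℚ) ≠ 0 := by positivity
  rw [key, sum_Lam1 μ s l ρ m hμ]
  field_simp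
end
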